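/- arXiv:math/0608474 — 4 statements merged into one kernel-verified Lean document; each statement's English description precedes it below -/
import Mathlib

section
/- For any graph sequence 𝒢 = {G_n} with each G_n connected, there exists a hyperfinite graph sequence ℋ = {H_n} with ℋ ≺ 𝒢; indeed, one may take H_n to be any spanning tree of G_n. -/
open Filter Function Set
open scoped Classical TensorProduct Pointwise symmDiff

universe u

namespace GraphSeqPaper

/-- The space of `K`-valued antisymmetric functions supported on the (oriented) edges of `G`:
the `K`-vector space spanned by the edges with the convention `(x,y) = -(y,x)`. -/
def edgeSpace (K : Type*) [Field K] {V : Type u} (G : SimpleGraph V) :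
    Submodule K (V → V → K) where
  carrier := {f | (∀ x y, ¬ G.Adj x y → f x y = 0) ∧ ∀ x y, f x y = - f y x}
  add_mem' := by
    rintro f g ⟨hf1, hf2⟩ ⟨hg1, hg2⟩
    refine ⟨fun x y h => ?_, fun x y => ?_⟩
    · simp only [Pi.add_apply, hf1 x y h, hg1 x y h, add_zero]
    · simp only [Pi.add_apply, hf2 x y, hg2 x y]; ring
  zero_mem' := ⟨fun x y _ => rfl, fun x y => by simp⟩
  smul_mem' := by
    rintro c f ⟨hf1, hf2⟩
    refine ⟨fun x y h => ?_, fun x y => ?_⟩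
    · simp only [Pi.smul_apply, hf1 x y h, smul_zero]
    · simp only [Pi.smul_apply, hf2 x y, smul_neg]

lemma edgeSpace_mono (K : Type*) [Field K] {V : Type u} {H G : SimpleGraph V}
    (h : H ≤ G) : edgeSpace K H ≤ edgeSpace K G :=
  fun f hf => ⟨fun x y hxy => hf.1 x y fun ha => hxy (h ha), hf.2⟩

/-- The basis vector of `ε_K` associated to the oriented edge `(x,y)`. -/
noncomputable def edgeVec (K : Type*) [Field K] {V : Type u} (x y : V) : V → V → K :=
  fun a b => if a = x ∧ b = y then (1 : K) else if a = y ∧ b = x then (-1 : K) else 0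

/-- The vector of a walk `(x₀, x₁, …, x_l)`, namely `Σ_{i} (x_i, x_{i+1})`. -/
noncomputable def walkVec (K : Type*) [Field K] {V : Type u} {G : SimpleGraph V} :
    ∀ {x y : V}, G.Walk x y → (V → V → K)
  | _, _, SimpleGraph.Walk.nil => 0
  | _, _, @SimpleGraph.Walk.cons _ _ a b _ _ p => edgeVec K a b + walkVec K p

/-- `C^q_K(G)`: the subspace of `ε_K(G)` spanned by the vectors of cycles of length at most
`q`. -/
noncomputable def cycleSpace (K : Type*) [Field K] {V : Type u} (G : SimpleGraph V) (q : ℕ) :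
    Submodule K (V → V → K) :=
  Submodule.span K
    {f | ∃ (x : V) (c : G.Walk x x), c.IsCycle ∧ c.length ≤ q ∧ f = walkVec K c}

/-- A graph sequence: finite simple graphs, of uniformly bounded vertex degrees, whose number
of vertices tends to infinity. -/
def IsGraphSeq (V : ℕ → Type u) (G : ∀ n, SimpleGraph (V n)) : Prop :=
  (∀ n, Finite (V n)) ∧
    (∃ D : ℕ, ∀ n (x : V n), ((G n).neighborSet x).ncard ≤ D) ∧
      Tendsto (fun n => Nat.card (V n)) atTop atTop

/-- `ℋ ≺ 𝒢`: there is an integer `L > 0` with `d_{G_n}(x,y) ≤ L · d_{H_n}(x,y)` for all `n`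
and all vertices `x, y`. -/
def Prec {V : ℕ → Type u} (H G : ∀ n, SimpleGraph (V n)) : Prop :=
  ∃ L : ℕ, 0 < L ∧ ∀ n (x y : V n), (G n).dist x y ≤ L * (H n).dist x y

/-- `𝒢 ≃ ℋ`: `ℋ ≺ 𝒢` and `𝒢 ≺ ℋ`. -/
def GEquiv {V : ℕ → Type u} (G H : ∀ n, SimpleGraph (V n)) : Prop :=
  Prec H G ∧ Prec G H

/-- The edge number `e(𝒢) = liminf |E(G_n)|/|V(G_n)|`. -/
noncomputable def edgeNum {V : ℕ → Type u} (G : ∀ n, SimpleGraph (V n)) : ℝ :=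
  liminf (fun n => ((G n).edgeSet.ncard : ℝ) / (Nat.card (V n) : ℝ)) atTop

/-- The cost `c(𝒢) = inf { e(ℋ) : ℋ ≃ 𝒢 }`. -/
noncomputable def cost {V : ℕ → Type u} (G : ∀ n, SimpleGraph (V n)) : ℝ :=
  sInf {r : ℝ | ∃ H : ∀ n, SimpleGraph (V n), IsGraphSeq V H ∧ GEquiv G H ∧ r = edgeNum H}

/-- `s^q_K(𝒢) = liminf (|E(G_n)| - dim_K C^q_K(G_n))/|V(G_n)| - 1`. -/
noncomputable def sInv (K : Type*) [Field K] {V : ℕ → Type u}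
    (G : ∀ n, SimpleGraph (V n)) (q : ℕ) : ℝ :=
  liminf (fun n =>
    (((G n).edgeSet.ncard : ℝ) - (Module.finrank K (cycleSpace K (G n) q) : ℝ)) /
      (Nat.card (V n) : ℝ)) atTop - 1

/-- `β_K(𝒢) = inf_q s^q_K(𝒢)`. -/
noncomputable def beta (K : Type*) [Field K] {V : ℕ → Type u}
    (G : ∀ n, SimpleGraph (V n)) : ℝ :=
  ⨅ q : ℕ, sInv K G q

/-- A large girth sequence: for every `k ≥ 1`, all but finitely many `G_n` contain no cycle of
length at most `k`. -/
def LargeGirth {V : ℕ → Type u} (G : ∀ n, SimpleGraph (V n)) : Prop :=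
  ∀ k : ℕ, 1 ≤ k → ∃ N : ℕ, ∀ n, N ≤ n →
    ∀ (x : V n) (c : (G n).Walk x x), c.IsCycle → k < c.length

/-- The set of edges of `G` whose two endpoints lie in different classes of the partition given
by the fibres of `P`. -/
def crossEdges {V : Type u} (G : SimpleGraph V) (P : V → ℕ) : Set (Sym2 V) :=
  {e | e ∈ G.edgeSet ∧ ∃ x ∈ e, ∃ y ∈ e, P x ≠ P y}

/-- Hyperfiniteness of a graph sequence. -/
def Hyperfinite {V : ℕ → Type u} (G : ∀ n, SimpleGraph (V n)) : Prop :=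
  ∀ ε : ℝ, 0 < ε → ∃ Kb : ℕ, ∃ P : ∀ n, V n → ℕ,
    (∀ n i, {x : V n | P n x = i}.ncard ≤ Kb) ∧
      liminf (fun n => ((crossEdges (G n) (P n)).ncard : ℝ) / (Nat.card (V n) : ℝ)) atTop ≤ ε

/-- The Cayley graph of a group with respect to a (symmetric) set `T`:
`x ~ y` iff `x ≠ y` and `y x⁻¹ ∈ T` (or `x y⁻¹ ∈ T`). -/
def cayley (Q : Type u) [Group Q] (T : Set Q) : SimpleGraph Q :=
  SimpleGraph.fromRel (fun x y => y * x⁻¹ ∈ T)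

/-- The Cayley graph of the quotient `Γ ⧸ N` with respect to the image of `S`. -/
def cayleyQuot {Γ : Type u} [Group Γ] (N : Subgroup Γ) (hN : N.Normal) (S : Set Γ) :
    SimpleGraph (Γ ⧸ N) :=
  haveI := hN
  cayley (Γ ⧸ N) ((fun g => (QuotientGroup.mk g : Γ ⧸ N)) '' S)

/-- The minimal number of generators of a group. -/
noncomputable def minGens (Λ : Type u) [Group Λ] : ℕ :=
  sInf {d : ℕ | ∃ T : Set Λ, T.Finite ∧ T.ncard = d ∧ Subgroup.closure T = ⊤}

/-- A group is finitely presented. -/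
def FinitelyPresentedGroup (Γ : Type u) [Group Γ] : Prop :=
  ∃ (n : ℕ) (f : FreeGroup (Fin n) →* Γ) (R : Set (FreeGroup (Fin n))),
    Surjective f ∧ R.Finite ∧ f.ker = Subgroup.normalClosure R

/-- Amenability via the Følner condition. -/
def IsAmenableFolner (Γ : Type u) [Group Γ] : Prop :=
  ∀ F : Set Γ, F.Finite → ∀ ε : ℝ, 0 < ε →
    ∃ A : Set Γ, A.Finite ∧ A.Nonempty ∧
      ∀ s ∈ F, (((s • A) ∆ A).ncard : ℝ) ≤ ε * A.ncard

/-- The set of edges of `G` joining `F` to its complement. -/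
def edgeBoundary {V : Type u} (G : SimpleGraph V) (F : Set V) : Set (Sym2 V) :=
  {e | e ∈ G.edgeSet ∧ ∃ x ∈ e, ∃ y ∈ e, x ∈ F ∧ y ∉ F}

/-- The `j`-th iterate of a map whose fibres have at most `D` elements has fibres with at most
`D ^ j` elements. -/
lemma card_fiber_iterate_le {α : Type*} [Fintype α] (p : α → α) (D : ℕ)
    (hp : ∀ u, (Finset.univ.filter fun v => p v = u).card ≤ D) (j : ℕ) (u : α) :
    (Finset.univ.filter fun v => p^[j] v = u).card ≤ D ^ j := by
  induction j with
  | zero =>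
    refine Finset.card_le_one.mpr fun a ha b hb => ?_
    exact (Finset.mem_filter.mp ha).2.trans (Finset.mem_filter.mp hb).2.symm
  | succ j ih =>
    refine (Finset.card_le_mul_card_image_of_maps_to (f := p)
      (t := Finset.univ.filter fun v => p^[j] v = u) (fun v hv => ?_) D
      fun w _ => ?_).trans ?_
    · exact Finset.mem_filter.mpr ⟨Finset.mem_univ _, (Finset.mem_filter.mp hv).2⟩
    · exact (Finset.card_le_card (Finset.filter_subset_filter _ (Finset.subset_univ _))).trans
        (hp w)
    · rw [pow_succ']
      exact Nat.mul_le_mul_left _ ih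

/-- A tree admits a parent map towards a root, together with a depth function. -/
lemma exists_parent_of_isTree {V : Type u} {T : SimpleGraph V} (hT : T.IsTree) :
    ∃ (p : V → V) (d : V → ℕ), (∀ v, p v = v ∨ T.Adj v (p v)) ∧
      ∀ x y, T.Adj x y → (p x = y ∧ d x = d y + 1) ∨ (p y = x ∧ d y = d x + 1) := by
  obtain ⟨r⟩ := hT.connected.nonempty
  choose q hq hlen using fun v => (hT.connected v r).exists_path_of_dist
  have key : ∀ x y, T.Adj x y → T.dist r x = T.dist r y + 1 → (q x).snd = y := by
    intro x y h hd
    have hpath : (SimpleGraph.Walk.cons h (q y)).IsPath := by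
      apply SimpleGraph.Walk.isPath_of_length_eq_dist
      rw [SimpleGraph.Walk.length_cons, hlen, T.dist_comm, T.dist_comm (u := x), hd]
    rw [(hT.existsUnique_path x r).unique (hq x) hpath]
    simp
  refine ⟨fun v => (q v).snd, fun v => T.dist r v, fun v => ?_, fun x y h => ?_⟩
  · by_cases hn : (q v).Nil
    · left
      have := hn.eq
      subst this
      change (q v).snd = v
      rw [SimpleGraph.Walk.eq_nil_iff_nil.mpr hn]
      rfl
    · exact Or.inr ((q v).adj_snd hn)
  · rcases hT.dist_eq_dist_add_one_of_adj r h with hd | hd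
    · exact Or.inl ⟨key x y h hd, hd⟩
    · exact Or.inr ⟨key y x h.symm hd, hd⟩

lemma add_one_mod_of_ne_zero {a k : ℕ} (h : (a + 1) % k ≠ 0) : (a + 1) % k = a % k + 1 := by
  have hmod : (a + 1) % k = (a % k + 1) % k := (Nat.mod_add_mod a k 1).symm
  rcases k.eq_zero_or_pos with rfl | hk
  · simp
  rcases (Nat.succ_le_of_lt (Nat.mod_lt a hk)).lt_or_eq with hlt | heq
  · rw [hmod, Nat.mod_eq_of_lt hlt]
  · rw [hmod, ← Nat.succ_eq_add_one, heq, Nat.mod_self] at h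
    exact absurd rfl h

/-- A finite tree with degrees at most `D` can be cut into pieces of size at most
`k * (D + 1) ^ k` by removing at most `|V| / k` edges. -/
lemma exists_partition_of_isTree {V : Type u} [Finite V] {T : SimpleGraph V} (hT : T.IsTree)
    {D : ℕ} (hD : ∀ x, (T.neighborSet x).ncard ≤ D) {k : ℕ} (hk : 0 < k) :
    ∃ P : V → ℕ, (∀ i, {x | P x = i}.ncard ≤ k * (D + 1) ^ k) ∧
      ((crossEdges T P).ncard : ℝ) ≤ (Nat.card V : ℝ) / k := by
  have := Fintype.ofFinite V
  obtain ⟨p, d, hp, hadj⟩ := exists_parent_of_isTree hT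
  obtain ⟨j, hj, hcard⟩ := Finset.exists_card_fiber_le_of_card_le_nsmul
    (s := (Finset.univ : Finset V)) (t := Finset.range k) (f := fun v => d v % k)
    (b := (Nat.card V : ℝ) / k)
    (Finset.nonempty_range_iff.mpr hk.ne') (by
      have : (k : ℝ) ≠ 0 := by positivity
      simp [mul_div_cancel₀, this])
  rw [Finset.mem_range] at hj
  set c : V → ℕ := fun v => (d v + (k - j)) % k with hc
  set f : V → V := fun v => p^[c v] v with hf
  have hfib : ∀ u, (Finset.univ.filter fun v => p v = u).card ≤ D + 1 := by
    intro u
    have hsub : (↑(Finset.univ.filter fun v => p v = u) : Set V) ⊆ insert u (T.neighborSet u) := by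
      intro v hv
      have hv : p v = u := by simpa using hv
      rcases hp v with h | h
      · exact Or.inl (h.symm.trans hv)
      · exact Or.inr (hv ▸ h.symm)
    rw [← Set.ncard_coe_finset]
    exact (Set.ncard_le_ncard hsub (Set.toFinite _)).trans
      ((Set.ncard_insert_le _ _).trans (Nat.add_le_add_right (hD u) 1))
  have hstep : ∀ x y, p x = y → d x = d y + 1 → d x % k ≠ j → f x = f y := by
    intro x y hxy hd hne
    have h0 : (d y + (k - j) + 1) % k ≠ 0 := by
      intro h
      apply hne
      have h1 : d x + (k - j) ≡ j + (k - j) [MOD k] := by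
        rw [show j + (k - j) = k by omega, Nat.ModEq, Nat.mod_self, ← h]
        congr 1
        omega
      have h2 := Nat.ModEq.add_right_cancel' _ h1
      rwa [Nat.ModEq, Nat.mod_eq_of_lt hj] at h2
    have h3 : c x = c y + 1 := by
      rw [hc]
      dsimp only
      rw [← add_one_mod_of_ne_zero h0, hd]
      congr 1
      omega
    simp only [hf, h3, Function.iterate_succ_apply, hxy]
  let e : V ≃ Fin (Nat.card V) := Finite.equivFin V
  refine ⟨fun v => e (f v), fun i => ?_, ?_⟩
  · by_cases hi : ∃ u, (e u : ℕ) = i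
    · obtain ⟨u, rfl⟩ := hi
      have hsub : {x | (e (f x) : ℕ) = e u} ⊆
          ↑((Finset.range k).biUnion fun s => Finset.univ.filter fun v => p^[s] v = u) := by
        intro x hx
        have hx : f x = u := e.injective (Fin.ext hx)
        simp only [Finset.coe_biUnion, Set.mem_iUnion]
        exact ⟨c x, by simpa using Nat.mod_lt _ hk, by simpa using hx⟩
      refine (Set.ncard_le_ncard hsub (Set.toFinite _)).trans ?_
      rw [Set.ncard_coe_finset]
      refine (Finset.card_biUnion_le_card_mul _ _ ((D + 1) ^ k) fun s hs => ?_).trans_eq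
        (by rw [Finset.card_range])
      exact (card_fiber_iterate_le p (D + 1) hfib s u).trans
        (Nat.pow_le_pow_right (Nat.succ_pos _) (Finset.mem_range.mp hs).le)
    · have : {x | (e (f x) : ℕ) = i} = ∅ :=
        Set.eq_empty_of_forall_notMem fun x hx => hi ⟨f x, hx⟩
      rw [this, Set.ncard_empty]
      exact Nat.zero_le _
  · refine le_trans ?_ hcard
    have hsub : crossEdges T (fun v => (e (f v) : ℕ)) ⊆
        (fun v => s(v, p v)) '' ↑(Finset.univ.filter fun v => d v % k = j) := by
      rintro z ⟨hz, x, hx, y, hy, hne⟩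
      have hfne : f x ≠ f y := fun h => hne (by simp only [h])
      have hxy : x ≠ y := fun h => hfne (by rw [h])
      obtain rfl : z = s(x, y) := (Sym2.mem_and_mem_iff hxy).mp ⟨hx, hy⟩
      rcases hadj x y hz with ⟨h, hd⟩ | ⟨h, hd⟩
      · refine ⟨x, ?_, by simp [h]⟩
        by_contra hcon
        exact hfne (hstep x y h hd (by simpa using hcon))
      · refine ⟨y, ?_, by simp [h, Sym2.eq_swap]⟩
        by_contra hcon
        exact hfne (hstep y x h hd (by simpa using hcon)).symm
    have hle := (Set.ncard_le_ncard hsub (Set.toFinite _)).trans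
      (Set.ncard_image_le (Set.toFinite _))
    rw [Set.ncard_coe_finset] at hle
    exact_mod_cast hle

theorem spanning_trees_hyperfinite_prec {V : ℕ → Type u}
    (G T : ∀ n, SimpleGraph (V n)) (hG : IsGraphSeq V G)
    (hconn : ∀ n, (G n).Connected) (hsub : ∀ n, T n ≤ G n) (htree : ∀ n, (T n).IsTree) :
    IsGraphSeq V T ∧ Hyperfinite T ∧ Prec T G := by
  obtain ⟨hfin, ⟨D, hD⟩, hcard⟩ := hG
  have hDT : ∀ n (x : V n), ((T n).neighborSet x).ncard ≤ D := fun n x =>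
    haveI := hfin n
    (Set.ncard_le_ncard (fun _ hy => hsub n hy) (Set.toFinite _)).trans (hD n x)
  refine ⟨⟨hfin, ⟨D, hDT⟩, hcard⟩, fun ε hε => ?_, 1, one_pos, fun n x y => ?_⟩
  · obtain ⟨m, hm⟩ := exists_nat_one_div_lt hε
    choose P hP hcross using fun n =>
      haveI := hfin n
      exists_partition_of_isTree (htree n) (hDT n) m.succ_pos
    refine ⟨(m + 1) * (D + 1) ^ (m + 1), P, hP, ?_⟩
    refine liminf_le_of_frequently_le (Eventually.of_forall fun n => ?_).frequently
      (isBoundedUnder_of ⟨0, fun n => by positivity⟩)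
    have := hfin n
    have := (hconn n).nonempty
    have hpos : (0 : ℝ) < Nat.card (V n) := by exact_mod_cast Nat.card_pos
    rw [div_le_iff₀ hpos]
    calc ((crossEdges (T n) (P n)).ncard : ℝ) ≤ Nat.card (V n) / (m.succ : ℕ) := hcross n
      _ = 1 / ((m : ℝ) + 1) * Nat.card (V n) := by push_cast; ring
      _ ≤ ε * Nat.card (V n) := by gcongr
  · rw [one_mul]
    exact SimpleGraph.Reachable.dist_anti (hsub n) ((htree n).connected x y)

end GraphSeqPaper
end

section
/- Let Γ be a finitely generated residually finite group with finite symmetric generating set S, let Γ ⊳ Γ_1 ⊳ Γ_2 ⊳ … be a nested sequence of finite-index normal subgroups with ∩_{n=1}^∞ Γ_n = {1} and [Γ:Γ_n] → ∞, and let 𝒢 = {G_n} be the graph sequence of Cayley graphs of Γ/Γ_n with respect to the image of S. Then 𝒢 is hyperfinite if and only if Γ is amenable. -/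
open Filter Function Set
open scoped Classical TensorProduct Pointwise symmDiff

universe u

namespace GraphSeqPaper

/-- The displacement of a finite set `A` by `g` is controlled by the displacements of `A` under
a generating set. -/
lemma exists_ncard_smul_symmDiff_le {Γ : Type u} [Group Γ] (S : Finset Γ)
    (hS : Subgroup.closure (S : Set Γ) = ⊤) (g : Γ) :
    ∃ L : ℕ, ∀ A : Set Γ, A.Finite →
      ((g • A) ∆ A).ncard ≤ L * ∑ s ∈ S, ((s • A) ∆ A).ncard := by
  have hg : g ∈ Subgroup.closure (S : Set Γ) := hS ▸ Subgroup.mem_top g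
  induction hg using Subgroup.closure_induction with
  | mem s hs =>
    refine ⟨1, fun A _ => ?_⟩
    rw [one_mul]
    exact Finset.single_le_sum (f := fun s => ((s • A) ∆ A).ncard) (fun _ _ => Nat.zero_le _) hs
  | one => exact ⟨0, fun A _ => by simp⟩
  | mul g h _ _ ihg ihh =>
    obtain ⟨L, hL⟩ := ihg
    obtain ⟨M, hM⟩ := ihh
    refine ⟨L + M, fun A hA => ?_⟩
    have hsub : ((g * h) • A) ∆ A ⊆ (g • ((h • A) ∆ A)) ∪ ((g • A) ∆ A) := by
      rw [Set.smul_set_symmDiff, smul_smul]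
      exact symmDiff_triangle _ _ _
    have hfin : ∀ k : Γ, ((k • A) ∆ A).Finite := fun k => (hA.smul_set).symmDiff hA
    calc _ ≤ ((g • ((h • A) ∆ A)) ∪ ((g • A) ∆ A)).ncard :=
          Set.ncard_le_ncard hsub ((hfin h).smul_set.union (hfin g))
      _ ≤ (g • ((h • A) ∆ A)).ncard + ((g • A) ∆ A).ncard := Set.ncard_union_le _ _
      _ = ((h • A) ∆ A).ncard + ((g • A) ∆ A).ncard := by rw [Set.ncard_smul_set]
      _ ≤ _ := by
        have h1 := hL A hA
        have h2 := hM A hA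
        rw [add_mul]
        omega
  | inv g _ ih =>
    obtain ⟨L, hL⟩ := ih
    refine ⟨L, fun A hA => ?_⟩
    have : (g⁻¹ • A) ∆ A = g⁻¹ • ((g • A) ∆ A) := by
      rw [Set.smul_set_symmDiff, inv_smul_smul, symmDiff_comm]
    rw [this, Set.ncard_smul_set]
    exact hL A hA

/-- If `A` is finite then `g • A` and `A` differ by at most twice the number of points which `g` moves
out of `A`. -/
lemma ncard_smul_symmDiff_le {Γ : Type u} [Group Γ] (g : Γ) (A : Finset Γ) :
    ((g • (A : Set Γ)) ∆ A).ncard ≤ 2 * (A.filter fun a => g * a ∉ A).card := by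
  have hA := A.finite_toSet
  have hgA : (g • (A : Set Γ)).Finite := hA.smul_set
  have h1 : ((g • (A : Set Γ)) \ A).ncard ≤ (A.filter fun a => g * a ∉ A).card := by
    rw [← Set.ncard_coe_finset, ← Set.ncard_smul_set g ((A.filter fun a => g * a ∉ A : Finset Γ) : Set Γ)]
    refine Set.ncard_le_ncard ?_ ((Finset.finite_toSet _).smul_set)
    rintro _ ⟨⟨a, ha, rfl⟩, hn⟩
    exact ⟨a, by simpa using ⟨ha, hn⟩, rfl⟩
  have h2 : ((A : Set Γ) \ (g • (A : Set Γ))).ncard = ((g • (A : Set Γ)) \ A).ncard :=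
    (Set.ncard_eq_ncard_iff_ncard_sdiff_eq_ncard_sdiff hA hgA).1 (Set.ncard_smul_set g _).symm
  rw [Set.symmDiff_def]
  have := Set.ncard_union_le ((g • (A : Set Γ)) \ A) ((A : Set Γ) \ (g • (A : Set Γ)))
  omega

lemma card_filter_mul_notMem_le {Γ : Type u} [Group Γ] (g : Γ) (A : Finset Γ) :
    (A.filter fun a => g * a ∉ A).card ≤ ((g • (A : Set Γ)) ∆ A).ncard := by
  rw [← Set.ncard_coe_finset, ← Set.ncard_smul_set g]
  refine Set.ncard_le_ncard ?_ (A.finite_toSet.smul_set.symmDiff A.finite_toSet)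
  rintro _ ⟨a, ha, rfl⟩
  rw [Finset.coe_filter] at ha
  exact Or.inl ⟨⟨a, ha.1, rfl⟩, ha.2⟩

/-- The endpoint of a walk along edges labelled by generators is the translate of its starting
point by a word of the same length. -/
lemma exists_mem_pow_smul_eq_of_walk {Γ Q : Type u} [Group Γ] [MulAction Γ Q] {T : Set Γ}
    {H : SimpleGraph Q} (hH : ∀ x y, H.Adj x y → ∃ s ∈ T, s • x = y) {x y : Q}
    (w : H.Walk x y) : ∃ g ∈ T ^ w.length, g • x = y := by
  induction w with
  | nil => exact ⟨1, by simp, one_smul _ _⟩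
  | cons h p ih =>
    obtain ⟨g, hg, rfl⟩ := ih
    obtain ⟨s, hs, rfl⟩ := hH _ _ h
    refine ⟨g * s, ?_, mul_smul _ _ _⟩
    rw [SimpleGraph.Walk.length_cons, pow_succ]
    exact Set.mul_mem_mul hg hs

lemma exists_walk_length_le {Q : Type u} [Finite Q] {H : SimpleGraph Q} {x y : Q}
    (h : H.Reachable x y) :
    ∃ w : H.Walk x y, w.length ≤ {z | H.Reachable x z}.ncard := by
  obtain ⟨p, hp⟩ := h.exists_isPath
  refine ⟨p, ?_⟩
  have h1 : p.support.toFinset.card = p.length + 1 := by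
    rw [List.toFinset_card_of_nodup hp.support_nodup, SimpleGraph.Walk.length_support]
  have h2 : p.support.toFinset.card ≤ {z | H.Reachable x z}.ncard := by
    rw [← Set.ncard_coe_finset]
    refine Set.ncard_le_ncard ?_ (Set.toFinite _)
    intro z hz
    exact ⟨p.takeUntil z (by simpa using hz)⟩
  omega

/-- Some class of a finite partition has relative boundary at most the average one. -/
lemma exists_class_boundary_le {Γ Q C : Type u} [Group Γ] [MulAction Γ Q] [Fintype Q] [Nonempty Q]
    (S : Finset Γ) (p : Q → C) :
    ∃ x : Q, (∑ s ∈ S, (Finset.univ.filter fun y => p y = p x ∧ p (s • y) ≠ p x).card) *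
        Fintype.card Q ≤
      (∑ s ∈ S, (Finset.univ.filter fun y : Q => p y ≠ p (s • y)).card) *
        (Finset.univ.filter fun y => p y = p x).card := by
  set c := ∑ s ∈ S, (Finset.univ.filter fun y : Q => p y ≠ p (s • y)).card
  let I : Finset C := Finset.univ.image p
  have hcard : ∑ i ∈ I, (Finset.univ.filter fun y => p y = i).card = Fintype.card Q :=
    (Finset.card_eq_sum_card_fiberwise (s := Finset.univ) (t := I) (f := p)
      fun x _ => by simp [I]).symm
  have hc : ∑ i ∈ I, ∑ s ∈ S, (Finset.univ.filter fun y => p y = i ∧ p (s • y) ≠ i).card = c := by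
    rw [Finset.sum_comm]
    refine Finset.sum_congr rfl fun s _ => ?_
    rw [Finset.card_eq_sum_card_fiberwise (t := I) (f := p) fun x _ => by simp [I]]
    refine Finset.sum_congr rfl fun i _ => ?_
    rw [Finset.filter_filter]
    congr 1
    ext y
    simp only [Finset.mem_filter, Finset.mem_univ, true_and]
    constructor
    · rintro ⟨rfl, h⟩
      exact ⟨h.symm, rfl⟩
    · rintro ⟨h, rfl⟩
      exact ⟨rfl, h.symm⟩
  have hI : I.Nonempty := Finset.univ_nonempty.image p
  have hle : ∑ i ∈ I, (∑ s ∈ S, (Finset.univ.filter fun y => p y = i ∧ p (s • y) ≠ i).card) *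
      Fintype.card Q ≤ ∑ i ∈ I, c * (Finset.univ.filter fun y => p y = i).card := by
    rw [← Finset.sum_mul, ← Finset.mul_sum, hcard, hc]
  obtain ⟨i, hi, h⟩ := Finset.exists_le_of_sum_le hI hle
  obtain ⟨x, -, rfl⟩ := Finset.mem_image.1 hi
  exact ⟨x, h⟩

/-- If `Γ` acts on a finite set partitioned into classes of at most `K` elements, and no nontrivial
short word fixes a point, then some finite subset of `Γ` has relative boundary at most twice that
of the partition. -/
lemma exists_finset_boundary_le {Γ Q : Type u} [Group Γ] [MulAction Γ Q] [Fintype Q] [Nonempty Q]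
    (S : Finset Γ) (hS : ∀ s ∈ S, s⁻¹ ∈ S) (P : Q → ℕ) (K : ℕ)
    (hP : ∀ i, {x | P x = i}.ncard ≤ K)
    (hfree : ∀ x : Q, ∀ g ∈ (insert 1 (S : Set Γ)) ^ (2 * K + 1), g • x = x → g = 1) :
    ∃ A : Finset Γ, A.Nonempty ∧
      (∑ s ∈ S, (A.filter fun a => s * a ∉ A).card) * Fintype.card Q ≤
        (∑ s ∈ S, (Finset.univ.filter fun y : Q => P y ≠ P (s • y)).card) * A.card := by
  set T : Set Γ := insert 1 (S : Set Γ) with hT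
  have hT1 : (1 : Γ) ∈ T := Set.mem_insert _ _
  have hTinv : T⁻¹ = T := by
    have : ∀ t ∈ T, t⁻¹ ∈ T := by
      rintro t (rfl | ht)
      · simp [hT]
      · exact Or.inr (hS t ht)
    ext t
    exact ⟨fun h => by simpa using this _ h, fun h => this _ h⟩
  let H : SimpleGraph Q := SimpleGraph.fromRel fun y z => P y = P z ∧ ∃ s ∈ S, s • y = z
  have hHP : ∀ x y, H.Adj x y → P x = P y := by
    rintro x y ⟨-, h | h⟩
    exacts [h.1, h.1.symm]
  have hHT : ∀ x y, H.Adj x y → ∃ s ∈ T, s • x = y := by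
    rintro x y ⟨-, ⟨-, s, hs, h⟩ | ⟨-, s, hs, h⟩⟩
    · exact ⟨s, Or.inr hs, h⟩
    · exact ⟨s⁻¹, Or.inr (hS s hs), by rw [← h, inv_smul_smul]⟩
  have hreach : ∀ x y, H.Reachable x y → P x = P y := by
    rintro x y ⟨w⟩
    induction w with
    | nil => rfl
    | cons h p ih => exact (hHP _ _ h).trans ih
  have hword : ∀ x y, H.Reachable x y → ∃ g ∈ T ^ K, g • x = y := by
    intro x y h
    obtain ⟨w, hw⟩ := exists_walk_length_le h
    obtain ⟨g, hg, hgx⟩ := exists_mem_pow_smul_eq_of_walk hHT w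
    refine ⟨g, Set.pow_subset_pow_right hT1 (hw.trans ?_) hg, hgx⟩
    exact (Set.ncard_le_ncard (fun z hz => (hreach x z hz).symm) (Set.toFinite _)).trans
      (hP (P x))
  obtain ⟨x, hx⟩ := exists_class_boundary_le S H.connectedComponentMk
  have hex : ∀ y, ∃ g : Γ, H.Reachable x y → g ∈ T ^ K ∧ g • x = y := by
    intro y
    by_cases h : H.Reachable x y
    · obtain ⟨g, hg⟩ := hword x y h
      exact ⟨g, fun _ => hg⟩
    · exact ⟨1, fun h' => absurd h' h⟩
  choose σ hσ using hex
  set C : Finset Q := Finset.univ.filter fun y =>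
    H.connectedComponentMk y = H.connectedComponentMk x with hC
  have hCr : ∀ y, y ∈ C ↔ H.Reachable x y := by
    intro y
    simp [hC, SimpleGraph.ConnectedComponent.eq, SimpleGraph.reachable_comm]
  have hinj : Set.InjOn σ C := by
    intro y hy z hz h
    rw [← (hσ y ((hCr y).1 hy)).2, ← (hσ z ((hCr z).1 hz)).2, h]
  refine ⟨C.image σ, ⟨σ x, Finset.mem_image_of_mem _ ((hCr x).2 (.refl x))⟩, ?_⟩
  rw [Finset.card_image_of_injOn hinj]
  refine le_trans (Nat.mul_le_mul_right _ (Finset.sum_le_sum fun s hs => ?_))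
    (hx.trans (Nat.mul_le_mul_right _ (Finset.sum_le_sum fun s hs => ?_)))
  · refine le_trans (Finset.card_le_card (t := (Finset.univ.filter fun y =>
      H.connectedComponentMk y = H.connectedComponentMk x ∧
        H.connectedComponentMk (s • y) ≠ H.connectedComponentMk x).image σ) ?_)
      Finset.card_image_le
    intro a ha
    obtain ⟨ha, hsa⟩ := Finset.mem_filter.1 ha
    obtain ⟨y, hy, rfl⟩ := Finset.mem_image.1 ha
    refine Finset.mem_image_of_mem _ (Finset.mem_filter.2 ⟨Finset.mem_univ _, ?_, ?_⟩)
    · simpa [hC] using hy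
    intro hsy
    have hsy' : s • y ∈ C := by simpa [hC] using hsy
    refine hsa (Finset.mem_image.2 ⟨s • y, hsy', ?_⟩)
    obtain ⟨h1, h2⟩ := hσ _ ((hCr _).1 hy)
    obtain ⟨h3, h4⟩ := hσ _ ((hCr _).1 hsy')
    have hmem : (σ (s • y))⁻¹ * (s * σ y) ∈ T ^ (2 * K + 1) := by
      have : T ^ (2 * K + 1) = T ^ K * (T * T ^ K) := by
        rw [← pow_succ', ← pow_add]
        congr 1
        omega
      rw [this]
      refine Set.mul_mem_mul ?_ (Set.mul_mem_mul (Or.inr hs) h1)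
      rw [← hTinv, inv_pow, Set.mem_inv, inv_inv]
      exact h3
    have := hfree x _ hmem (by
      rw [mul_smul, mul_smul, h2, inv_smul_eq_iff, h4])
    exact (inv_mul_eq_one.1 this)
  · refine Finset.card_le_card fun y hy => ?_
    simp only [Finset.mem_filter, Finset.mem_univ, true_and] at hy ⊢
    refine fun h => hy ?_
    by_cases hne : y = s • y
    · rw [← hne]
    · have : H.Adj y (s • y) := ⟨hne, Or.inl ⟨h, s, hs, rfl⟩⟩
      exact SimpleGraph.ConnectedComponent.eq.2 this.reachable

lemma sum_card_filter_smul_mem {Γ Q : Type u} [Group Γ] [MulAction Γ Q] [Fintype Q]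
    (E : Finset Γ) (Y : Finset Q) :
    ∑ x : Q, (E.filter fun f => f • x ∈ Y).card = E.card * Y.card := by
  simp_rw [Finset.card_filter]
  rw [Finset.sum_comm, ← smul_eq_mul, ← Finset.sum_const]
  refine Finset.sum_congr rfl fun f _ => ?_
  rw [← Finset.card_filter]
  refine Finset.card_bij (fun x _ => f • x) (fun x hx => (Finset.mem_filter.1 hx).2)
    (fun x _ y _ h => smul_left_cancel f h) fun y hy => ⟨f⁻¹ • y, ?_, smul_inv_smul f y⟩
  simpa using hy

/-- A translate of a Følner set meets a given set of vertices in a piece of small relative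
boundary. -/
lemma exists_piece_boundary_le {Γ Q : Type u} [Group Γ] [MulAction Γ Q] [Fintype Q]
    (S F : Finset Γ) (hF : F.Nonempty) (hinj : ∀ x : Q, Set.InjOn (fun f : Γ => f • x) F)
    {ε : ℝ} (hε : ((∑ s ∈ S, (F.filter fun f => s * f ∉ F).card : ℕ) : ℝ) ≤ ε * F.card)
    {Y : Finset Q} (hY : Y.Nonempty) :
    ∃ A ⊆ Y, A.Nonempty ∧ A.card ≤ F.card ∧
      ((∑ s ∈ S, (A.filter fun y => s • y ∈ Y \ A).card : ℕ) : ℝ) ≤ ε * A.card := by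
  let A : Q → Finset Q := fun x => (F.filter fun f => f • x ∈ Y).image fun f => f • x
  have hAcard : ∀ x, (A x).card = (F.filter fun f => f • x ∈ Y).card := fun x =>
    Finset.card_image_of_injOn ((hinj x).mono (Finset.coe_subset.2 (Finset.filter_subset _ _)))
  have hbd : ∀ x, ∑ s ∈ S, ((A x).filter fun y => s • y ∈ Y \ A x).card ≤
      ∑ s ∈ S, ((F.filter fun f => s * f ∉ F).filter fun f => f • x ∈ Y).card := by
    refine fun x => Finset.sum_le_sum fun s _ => ?_
    refine le_trans (Finset.card_le_card (t := ((F.filter fun f => s * f ∉ F).filter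
      fun f => f • x ∈ Y).image fun f => f • x) ?_) Finset.card_image_le
    intro y hy
    simp only [A, Finset.mem_filter, Finset.mem_image, Finset.mem_sdiff] at hy ⊢
    obtain ⟨⟨f, ⟨hfF, hfY⟩, rfl⟩, hsY, hs⟩ := hy
    refine ⟨f, ⟨⟨hfF, fun h => hs ⟨s * f, ⟨h, ?_⟩, mul_smul _ _ _⟩⟩, hfY⟩, rfl⟩
    rwa [mul_smul]
  by_contra! hcon
  have hlt : ∀ x, (A x).Nonempty → ε * (A x).card <
      ((∑ s ∈ S, ((A x).filter fun y => s • y ∈ Y \ A x).card : ℕ) : ℝ) := by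
    refine fun x hx => hcon (A x) ?_ hx ?_
    · intro y hy
      obtain ⟨f, hf, rfl⟩ := Finset.mem_image.1 hy
      exact (Finset.mem_filter.1 hf).2
    · rw [hAcard]
      exact Finset.card_filter_le _ _
  have hsum : ∑ x : Q, ε * ((A x).card : ℝ) <
      ∑ x : Q, ((∑ s ∈ S, ((A x).filter fun y => s • y ∈ Y \ A x).card : ℕ) : ℝ) := by
    refine Finset.sum_lt_sum (fun x _ => ?_) ?_
    · rcases (A x).eq_empty_or_nonempty with h | h
      · simp [h]
      · exact (hlt x h).le
    · obtain ⟨y, hy⟩ := hY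
      obtain ⟨f, hf⟩ := hF
      refine ⟨f⁻¹ • y, Finset.mem_univ _, hlt _ ⟨y, ?_⟩⟩
      exact Finset.mem_image.2 ⟨f, by simp [hf, hy], smul_inv_smul f y⟩
  have htot : ∑ x : Q, ∑ s ∈ S, ((A x).filter fun y => s • y ∈ Y \ A x).card ≤
      (∑ s ∈ S, (F.filter fun f => s * f ∉ F).card) * Y.card := by
    refine (Finset.sum_le_sum fun x _ => hbd x).trans_eq ?_
    rw [Finset.sum_comm, Finset.sum_mul]
    exact Finset.sum_congr rfl fun s _ => sum_card_filter_smul_mem _ _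
  have hAtot : ∑ x : Q, (A x).card = F.card * Y.card := by
    rw [← sum_card_filter_smul_mem]
    exact Finset.sum_congr rfl fun x _ => hAcard x
  rw [← Finset.mul_sum, ← Nat.cast_sum, ← Nat.cast_sum, hAtot] at hsum
  have h1 : ((∑ x : Q, ∑ s ∈ S, ((A x).filter fun y => s • y ∈ Y \ A x).card : ℕ) : ℝ) ≤
      ((∑ s ∈ S, (F.filter fun f => s * f ∉ F).card : ℕ) : ℝ) * Y.card := by
    exact_mod_cast htot
  have h2 := mul_le_mul_of_nonneg_right hε (Nat.cast_nonneg (α := ℝ) Y.card)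
  push_cast at hsum h1 h2
  linarith

/-- Greedily removing pieces of small boundary partitions a set of vertices into classes of at most
`F.card` elements with few edges between different classes. -/
lemma exists_partition_crossEdges_le {Γ Q : Type u} [Group Γ] [MulAction Γ Q] [Fintype Q]
    {G : SimpleGraph Q} (S F : Finset Γ)
    (hG : ∀ x y, G.Adj x y → ∃ s ∈ S, s • x = y)
    (hF : F.Nonempty) (hinj : ∀ x : Q, Set.InjOn (fun f : Γ => f • x) F)
    {ε : ℝ} (hε : ((∑ s ∈ S, (F.filter fun f => s * f ∉ F).card : ℕ) : ℝ) ≤ ε * F.card)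
    (Y : Finset Q) :
    ∃ P : Q → ℕ, (∀ i, (Y.filter fun y => P y = i).card ≤ F.card) ∧
      (({e | e ∈ crossEdges G P ∧ ∀ x ∈ e, x ∈ Y}.ncard : ℕ) : ℝ) ≤ ε * Y.card := by
  induction Y using Finset.strongInduction with
  | H Y ih =>
    rcases Y.eq_empty_or_nonempty with rfl | hY
    · refine ⟨fun _ => 0, by simp, ?_⟩
      have : {e | e ∈ crossEdges G (fun _ => 0) ∧ ∀ x ∈ e, x ∈ (∅ : Finset Q)} = ∅ := by
        ext e
        simp [crossEdges]
      rw [this]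
      simp
    · obtain ⟨A, hAY, hA, hAF, hAε⟩ := exists_piece_boundary_le S F hF hinj hε hY
      obtain ⟨P, hP, hPε⟩ := ih (Y \ A) (Finset.sdiff_ssubset hAY hA)
      let P' : Q → ℕ := fun y => if y ∈ A then 0 else P y + 1
      refine ⟨P', fun i => ?_, ?_⟩
      · cases i with
        | zero =>
          refine (Finset.card_le_card fun y hy => ?_).trans hAF
          by_contra h
          simp [P', h] at hy
        | succ i =>
          refine (Finset.card_le_card fun y hy => ?_).trans (hP i)
          by_cases h : y ∈ A
          · simp [P', h] at hy
          · simpa [P', h] using hy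
      · have hsub : {e | e ∈ crossEdges G P' ∧ ∀ x ∈ e, x ∈ Y} ⊆
            {e | e ∈ crossEdges G P ∧ ∀ x ∈ e, x ∈ Y \ A} ∪
              ((S.biUnion fun s => (A.filter fun y => s • y ∈ Y \ A).image
                fun y => s(y, s • y) : Finset (Sym2 Q)) : Set (Sym2 Q)) := by
          have key : ∀ x y, G.Adj x y → x ∈ A → y ∈ Y → y ∉ A → s(x, y) ∈
              (S.biUnion fun s => (A.filter fun y => s • y ∈ Y \ A).image
                fun y => s(y, s • y) : Finset (Sym2 Q)) := by
            intro x y hxy hx hy hyA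
            obtain ⟨s, hs, rfl⟩ := hG x y hxy
            exact Finset.mem_biUnion.2 ⟨s, hs, Finset.mem_image.2
              ⟨x, Finset.mem_filter.2 ⟨hx, Finset.mem_sdiff.2 ⟨hy, hyA⟩⟩, rfl⟩⟩
          rintro e ⟨⟨he, x, hx, y, hy, hxy⟩, heY⟩
          have hne : x ≠ y := fun h => hxy (by rw [h])
          obtain rfl : e = s(x, y) := (Sym2.mem_and_mem_iff hne).1 ⟨hx, hy⟩
          have hxY := heY x hx
          have hyY := heY y hy
          by_cases hxA : x ∈ A <;> by_cases hyA : y ∈ A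
          · simp [P', hxA, hyA] at hxy
          · exact Or.inr (key x y he hxA hyY hyA)
          · refine Or.inr ?_
            rw [Sym2.eq_swap]
            exact key y x (SimpleGraph.Adj.symm he) hyA hxY hxA
          · refine Or.inl ⟨⟨he, x, hx, y, hy, ?_⟩, ?_⟩
            · simpa [P', hxA, hyA] using hxy
            · intro z hz
              rcases Sym2.mem_iff.1 hz with rfl | rfl
              · exact Finset.mem_sdiff.2 ⟨hxY, hxA⟩
              · exact Finset.mem_sdiff.2 ⟨hyY, hyA⟩
        have h1 := (Set.ncard_le_ncard hsub (Set.toFinite _)).trans (Set.ncard_union_le _ _)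
        have h2 : ((S.biUnion fun s => (A.filter fun y => s • y ∈ Y \ A).image
            fun y => s(y, s • y) : Finset (Sym2 Q)) : Set (Sym2 Q)).ncard ≤
              ∑ s ∈ S, (A.filter fun y => s • y ∈ Y \ A).card := by
          rw [Set.ncard_coe_finset]
          exact Finset.card_biUnion_le.trans (Finset.sum_le_sum fun _ _ => Finset.card_image_le)
        have h3 : ((({e | e ∈ crossEdges G P' ∧ ∀ x ∈ e, x ∈ Y}).ncard : ℕ) : ℝ) ≤
            (({e | e ∈ crossEdges G P ∧ ∀ x ∈ e, x ∈ Y \ A}.ncard : ℕ) : ℝ) +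
              ((∑ s ∈ S, (A.filter fun y => s • y ∈ Y \ A).card : ℕ) : ℝ) := by
          exact_mod_cast h1.trans (Nat.add_le_add_left h2 _)
        have h4 : (Y.card : ℝ) = ((Y \ A).card : ℝ) + A.card := by
          exact_mod_cast (Finset.card_sdiff_add_card_eq_card hAY).symm
        rw [h4, mul_add]
        linarith

lemma cayleyQuot_adj_iff {Γ : Type u} [Group Γ] (N : Subgroup Γ) (hN : N.Normal) {S : Set Γ}
    (hS : ∀ s ∈ S, s⁻¹ ∈ S) (x y : Γ ⧸ N) :
    (cayleyQuot N hN S).Adj x y ↔ x ≠ y ∧ ∃ s ∈ S, s • x = y := by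
  have key : ∀ (s : Γ) (a b : Γ ⧸ N), (QuotientGroup.mk s : Γ ⧸ N) = b * a⁻¹ ↔ s • a = b := by
    intro s a b
    rw [eq_mul_inv_iff_mul_eq]
    induction a using QuotientGroup.induction_on
    rfl
  simp only [cayleyQuot, cayley, SimpleGraph.fromRel_adj, Set.mem_image, key]
  refine and_congr_right fun _ => ⟨?_, Or.inl⟩
  rintro (h | ⟨s, hs, rfl⟩)
  · exact h
  · exact ⟨s⁻¹, hS s hs, inv_smul_smul _ _⟩

lemma mem_of_smul_quotient_eq {Γ : Type u} [Group Γ] {N : Subgroup Γ} (hN : N.Normal) {g : Γ}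
    {x : Γ ⧸ N} (h : g • x = x) : g ∈ N := by
  induction x using QuotientGroup.induction_on with
  | H a =>
    have h1 : (QuotientGroup.mk a : Γ ⧸ N) = QuotientGroup.mk (g * a) := h.symm
    have h2 := hN.conj_mem _ (QuotientGroup.eq.1 h1) a
    simpa [mul_assoc] using h2

/-- A decreasing sequence of subgroups with trivial intersection eventually avoids the nontrivial
elements of a given finite set. -/
lemma eventually_inter_trivial {Γ : Type u} [Group Γ] {N : ℕ → Subgroup Γ} (hN : Antitone N)
    (hinter : ⨅ n, N n = ⊥) {B : Set Γ} (hB : B.Finite) :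
    ∀ᶠ n in atTop, ∀ g ∈ B, g ∈ N n → g = 1 := by
  refine (Set.Finite.eventually_all hB).2 fun g _ => ?_
  by_cases hg : g = 1
  · exact Eventually.of_forall fun _ _ => hg
  · have : g ∉ ⨅ n, N n := by rwa [hinter, Subgroup.mem_bot]
    rw [Subgroup.mem_iInf] at this
    push Not at this
    obtain ⟨m, hm⟩ := this
    filter_upwards [eventually_ge_atTop m] with n hn h
    exact absurd (hN hn h) hm

lemma card_filter_ne_le_crossEdges {Γ Q : Type u} [Group Γ] [MulAction Γ Q] [Fintype Q]
    {G : SimpleGraph Q} {s : Γ} (hG : ∀ x, x ≠ s • x → G.Adj x (s • x)) (P : Q → ℕ) :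
    (Finset.univ.filter fun y : Q => P y ≠ P (s • y)).card ≤ 2 * (crossEdges G P).ncard := by
  refine (Finset.card_le_mul_card_image (f := fun y => s(y, s • y)) _ 2 ?_).trans
    (Nat.mul_le_mul_left 2 ?_)
  · intro e he
    obtain ⟨y, -, rfl⟩ := Finset.mem_image.1 he
    refine (Finset.card_le_card (t := {y, s • y}) fun z hz => ?_).trans Finset.card_le_two
    have hz' : s(z, s • z) = s(y, s • y) := (Finset.mem_filter.1 hz).2
    have : z ∈ s(y, s • y) := hz' ▸ Sym2.mem_mk_left _ _
    simpa using this
  · rw [← Set.ncard_coe_finset]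
    refine Set.ncard_le_ncard ?_ (Set.toFinite _)
    intro e he
    obtain ⟨y, hy, rfl⟩ := Finset.mem_image.1 (Finset.mem_coe.1 he)
    have hy' : P y ≠ P (s • y) := (Finset.mem_filter.1 hy).2
    exact ⟨hG y fun h => hy' (congrArg P h), y, Sym2.mem_mk_left _ _, s • y,
      Sym2.mem_mk_right _ _, hy'⟩

lemma ncard_crossEdges_le {Γ Q : Type u} [Group Γ] [MulAction Γ Q] [Fintype Q]
    {G : SimpleGraph Q} {S : Finset Γ} (hG : ∀ x y, G.Adj x y → ∃ s ∈ S, s • x = y) (P : Q → ℕ) :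
    (crossEdges G P).ncard ≤ S.card * Fintype.card Q := by
  have hsub : crossEdges G P ⊆
      (((S ×ˢ (Finset.univ : Finset Q)).image fun p => s(p.2, p.1 • p.2) : Finset (Sym2 Q)) :
        Set (Sym2 Q)) := by
    rintro e ⟨he, -⟩
    induction e using Sym2.ind with
    | _ x y =>
      obtain ⟨s, hs, rfl⟩ := hG x y he
      exact Finset.mem_coe.2 (Finset.mem_image.2 ⟨(s, x), by simp [hs], rfl⟩)
  refine (Set.ncard_le_ncard hsub (Set.toFinite _)).trans ?_
  rw [Set.ncard_coe_finset]
  exact Finset.card_image_le.trans (by rw [Finset.card_product, Finset.card_univ])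

lemma isAmenableFolner_of_hyperfinite {Γ : Type u} [Group Γ] (S : Finset Γ)
    (hS : ∀ s ∈ S, s⁻¹ ∈ S) (hSgen : Subgroup.closure (S : Set Γ) = ⊤)
    {N : ℕ → Subgroup Γ} (hnorm : ∀ n, (N n).Normal) (hN : Antitone N)
    (hfi : ∀ n, (N n).FiniteIndex) (hinter : ⨅ n, N n = ⊥)
    (h : Hyperfinite (fun n => cayleyQuot (N n) (hnorm n) (S : Set Γ))) :
    IsAmenableFolner Γ := by
  intro F hF ε hε
  have hadj := fun n => cayleyQuot_adj_iff (N n) (hnorm n) (S := (S : Set Γ)) hS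
  have : ∀ n, Fintype (Γ ⧸ N n) := fun n => Fintype.ofFinite _
  choose L hL using exists_ncard_smul_symmDiff_le S hSgen
  set M : ℕ := ∑ g ∈ hF.toFinset, L g with hM
  set δ : ℝ := ε / (4 * S.card * M + 1) with hδ
  have hδ0 : 0 < δ := by positivity
  have hδε : 4 * S.card * M * δ ≤ ε := by
    have : δ * (4 * S.card * M + 1) = ε := div_mul_cancel₀ _ (by positivity)
    linarith
  obtain ⟨K, P, hPK, hlim⟩ := h (δ / 2) (by positivity)
  have hcob : IsCoboundedUnder (· ≥ ·) atTop (fun n =>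
      ((crossEdges (cayleyQuot (N n) (hnorm n) (S : Set Γ)) (P n)).ncard : ℝ) /
        (Nat.card (Γ ⧸ N n) : ℝ)) := by
    refine (isBoundedUnder_of ⟨(S.card : ℝ), fun n => ?_⟩ :
      IsBoundedUnder (· ≤ ·) _ _).isCoboundedUnder_ge
    refine div_le_of_le_mul₀ (by positivity) (by positivity) ?_
    rw [Nat.card_eq_fintype_card]
    exact_mod_cast ncard_crossEdges_le (fun x y hxy => ((hadj n x y).1 hxy).2) (P n)
  have hfreq := frequently_lt_of_liminf_lt hcob (hlim.trans_lt (half_lt_self hδ0))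
  have hB : ((insert 1 (S : Set Γ)) ^ (2 * K + 1)).Finite := by
    simpa using ((insert 1 S : Finset Γ) ^ (2 * K + 1)).finite_toSet
  obtain ⟨n, hn, hfree⟩ := (hfreq.and_eventually (eventually_inter_trivial hN hinter hB)).exists
  obtain ⟨A, hA, hAle⟩ := exists_finset_boundary_le (Q := Γ ⧸ N n) S hS (P n) K (hPK n)
    fun x g hg hgx => hfree g hg (mem_of_smul_quotient_eq (hnorm n) hgx)
  set c := (crossEdges (cayleyQuot (N n) (hnorm n) (S : Set Γ)) (P n)).ncard
  have hq : 0 < (Fintype.card (Γ ⧸ N n) : ℝ) := by exact_mod_cast Fintype.card_pos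
  have hc : (c : ℝ) ≤ δ * Fintype.card (Γ ⧸ N n) := by
    rw [Nat.card_eq_fintype_card] at hn
    exact ((div_lt_iff₀ hq).1 hn).le
  have hsum : ∑ s ∈ S, (Finset.univ.filter fun y : Γ ⧸ N n => P n y ≠ P n (s • y)).card ≤
      S.card * (2 * c) := by
    rw [← smul_eq_mul]
    exact Finset.sum_le_card_nsmul _ _ _ fun s hs => card_filter_ne_le_crossEdges
      (fun x hx => (hadj n _ _).2 ⟨hx, s, hs, rfl⟩) (P n)
  set b := ∑ s ∈ S, (A.filter fun a => s * a ∉ A).card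
  have hb : (b : ℝ) ≤ 2 * S.card * δ * A.card := by
    have h1 : (b : ℝ) * Fintype.card (Γ ⧸ N n) ≤ S.card * (2 * c) * A.card := by
      exact_mod_cast hAle.trans (Nat.mul_le_mul_right _ hsum)
    refine le_of_mul_le_mul_right (h1.trans ?_) hq
    calc (S.card : ℝ) * (2 * c) * A.card
        ≤ S.card * (2 * (δ * Fintype.card (Γ ⧸ N n))) * A.card := by gcongr
      _ = _ := by ring
  refine ⟨A, A.finite_toSet, hA, fun g hg => ?_⟩
  have h1 : ((g • (A : Set Γ)) ∆ A).ncard ≤ M * (2 * b) := by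
    refine (hL g A A.finite_toSet).trans (Nat.mul_le_mul ?_ ?_)
    · exact Finset.single_le_sum (fun _ _ => Nat.zero_le _) (hF.mem_toFinset.2 hg)
    · rw [Finset.mul_sum]
      exact Finset.sum_le_sum fun s _ => ncard_smul_symmDiff_le s A
  rw [Set.ncard_coe_finset]
  calc (((g • (A : Set Γ)) ∆ A).ncard : ℝ) ≤ M * (2 * b) := by exact_mod_cast h1
    _ ≤ M * (2 * (2 * S.card * δ * A.card)) := by gcongr
    _ = 4 * S.card * M * δ * A.card := by ring
    _ ≤ ε * A.card := by gcongr

lemma hyperfinite_of_isAmenableFolner {Γ : Type u} [Group Γ] (S : Finset Γ)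
    (hS : ∀ s ∈ S, s⁻¹ ∈ S)
    {N : ℕ → Subgroup Γ} (hnorm : ∀ n, (N n).Normal) (hN : Antitone N)
    (hfi : ∀ n, (N n).FiniteIndex) (hinter : ⨅ n, N n = ⊥) (h : IsAmenableFolner Γ) :
    Hyperfinite (fun n => cayleyQuot (N n) (hnorm n) (S : Set Γ)) := by
  intro ε hε
  have hadj := fun n => cayleyQuot_adj_iff (N n) (hnorm n) (S := (S : Set Γ)) hS
  have : ∀ n, Fintype (Γ ⧸ N n) := fun n => Fintype.ofFinite _
  obtain ⟨A, hAfin, hA, hAε⟩ := h S S.finite_toSet (ε / (S.card + 1)) (by positivity)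
  lift A to Finset Γ using hAfin
  have hbd : ((∑ s ∈ S, (A.filter fun f => s * f ∉ A).card : ℕ) : ℝ) ≤ ε * A.card := by
    push_cast
    calc _ ≤ ∑ s ∈ S, ε / (S.card + 1) * (A.card : ℝ) := by
          refine Finset.sum_le_sum fun s hs => ?_
          have h1 := hAε s hs
          rw [Set.ncard_coe_finset] at h1
          exact le_trans (by exact_mod_cast card_filter_mul_notMem_le s A) h1
      _ = (ε / (S.card + 1) * S.card) * A.card := by
          rw [Finset.sum_const, nsmul_eq_mul]
          ring
      _ ≤ ε * A.card := by
          gcongr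
          rw [div_mul_eq_mul_div, div_le_iff₀ (by positivity)]
          linarith
  have hex : ∀ n, ∃ P : Γ ⧸ N n → ℕ, (∀ i, {x | P x = i}.ncard ≤ A.card) ∧
      ((∀ g ∈ (A : Set Γ)⁻¹ * A, g ∈ N n → g = 1) →
        ((crossEdges (cayleyQuot (N n) (hnorm n) (S : Set Γ)) P).ncard : ℝ) /
          (Nat.card (Γ ⧸ N n) : ℝ) ≤ ε) := by
    intro n
    by_cases hn : ∀ g ∈ (A : Set Γ)⁻¹ * A, g ∈ N n → g = 1
    · have hinj : ∀ x : Γ ⧸ N n, Set.InjOn (fun f : Γ => f • x) A := by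
        intro x f hf g hg hfg
        refine (inv_mul_eq_one.1 (hn (g⁻¹ * f) (Set.mul_mem_mul (by simpa using hg) hf)
          (mem_of_smul_quotient_eq (hnorm n) (x := x) ?_))).symm
        rw [mul_smul, inv_smul_eq_iff]
        exact hfg
      obtain ⟨P, hP, hPε⟩ := exists_partition_crossEdges_le S A
        (fun x y hxy => ((hadj n x y).1 hxy).2) hA hinj hbd Finset.univ
      refine ⟨P, fun i => ?_, fun _ => div_le_of_le_mul₀ (by positivity) hε.le ?_⟩
      · refine le_trans (le_of_eq ?_) (hP i)
        rw [← Set.ncard_coe_finset]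
        simp
      · simpa [Nat.card_eq_fintype_card] using hPε
    · refine ⟨fun x => Fintype.equivFin _ x, fun i => ?_, fun h => absurd h hn⟩
      refine le_trans ((Set.ncard_le_one_iff (Set.toFinite _)).2 fun {a b} ha hb => ?_) (Finset.card_pos.2 hA)
      exact (Fintype.equivFin _).injective (Fin.ext (Eq.trans ha (Eq.symm hb)))
  choose P hPK hPε using hex
  refine ⟨A.card, P, hPK, ?_⟩
  have hB : ((A : Set Γ)⁻¹ * A).Finite := A.finite_toSet.inv.mul A.finite_toSet
  refine liminf_le_of_frequently_le ?_
    (isBoundedUnder_of ⟨0, fun n => div_nonneg (Nat.cast_nonneg _) (Nat.cast_nonneg _)⟩)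
  exact ((eventually_inter_trivial hN hinter hB).mono fun n hn => hPε n hn).frequently

theorem hyperfinite_iff_amenable {Γ : Type u} [Group Γ] (S : Set Γ)
    (hSfin : S.Finite) (hSsym : ∀ s ∈ S, s⁻¹ ∈ S) (hSgen : Subgroup.closure S = ⊤)
    (N : ℕ → Subgroup Γ) (hnorm : ∀ n, (N n).Normal)
    (hnested : ∀ n, N (n + 1) ≤ N n) (hfi : ∀ n, (N n).FiniteIndex)
    (hinter : ⨅ n, N n = ⊥)
    (hidx : Tendsto (fun n => (N n).index) atTop atTop) :
    Hyperfinite (fun n => cayleyQuot (N n) (hnorm n) S) ↔ IsAmenableFolner Γ := by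
  lift S to Finset Γ using hSfin
  have hN : Antitone N := antitone_nat_of_succ_le hnested
  exact ⟨isAmenableFolner_of_hyperfinite S hSsym hSgen hnorm hN hfi hinter,
    hyperfinite_of_isAmenableFolner S hSsym hnorm hN hfi hinter⟩

end GraphSeqPaper
end

section
/- Let Γ be a finitely generated non-amenable group with finite symmetric generating set S, and suppose δ > 0 is such that every finite subset F ⊂ Γ has at least δ|F| edges of the Cayley graph of (Γ,S) joining F to its complement. Let Γ ⊳ Γ_1 ⊳ Γ_2 ⊳ … be a nested sequence of finite-index normal subgroups with ∩_{n=1}^∞ Γ_n = {1}, and let G_n be the Cayley graph of Γ/Γ_n with respect to the image of S. Then for every integer m > 0 there exists N such that for all n ≥ N, every subset M ⊆ Γ/Γ_n with |M| ≤ m has at least δ|M| edges of G_n joining M to its complement. -/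
open Filter Function Set
open scoped Classical TensorProduct Pointwise symmDiff

universe u

namespace GraphSeqPaper

lemma cayley_adj {Q : Type u} [Group Q] {T : Set Q} (hT : ∀ t ∈ T, t⁻¹ ∈ T) {x y : Q} :
    (cayley Q T).Adj x y ↔ x ≠ y ∧ ∃ t ∈ T, y = t * x := by
  have key : y * x⁻¹ ∈ T ↔ ∃ t ∈ T, y = t * x :=
    ⟨fun h => ⟨_, h, by group⟩, by rintro ⟨t, ht, rfl⟩; simpa using ht⟩
  rw [cayley, SimpleGraph.fromRel_adj, ← key, and_congr_right_iff]
  exact fun _ => ⟨fun h => h.elim id fun h => by simpa using hT _ h, Or.inl⟩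

lemma cayleyQuot_adj {Γ : Type u} [Group Γ] {N : Subgroup Γ} [hN : N.Normal] {S : Set Γ}
    (hS : ∀ s ∈ S, s⁻¹ ∈ S) {x y : Γ ⧸ N} :
    (cayleyQuot N hN S).Adj x y ↔ x ≠ y ∧ ∃ s ∈ S, y = (s : Γ ⧸ N) * x := by
  rw [cayleyQuot, cayley_adj, exists_mem_image]
  rintro _ ⟨s, hs, rfl⟩
  exact ⟨s⁻¹, hS s hs, rfl⟩

/-- The endpoint of a walk of length `k` in the Cayley graph of `Γ ⧸ N`, restricted to a set of
vertices, is the translate of its starting point by a word of length at most `k`. -/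
lemma exists_mem_pow_of_walk {Γ : Type u} [Group Γ] {N : Subgroup Γ} [hN : N.Normal]
    {S : Set Γ} (hS : ∀ s ∈ S, s⁻¹ ∈ S) {M : Set (Γ ⧸ N)} {p q : M}
    (w : ((cayleyQuot N hN S).induce M).Walk p q) :
    ∃ g ∈ insert 1 S ^ w.length, (q : Γ ⧸ N) = (g : Γ ⧸ N) * p := by
  induction w with
  | nil => exact ⟨1, by simp, by simp⟩
  | cons h w ih =>
    obtain ⟨g, hg, hq⟩ := ih
    obtain ⟨-, s, hs, hb⟩ := (cayleyQuot_adj hS).1 (SimpleGraph.comap_adj.1 h)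
    refine ⟨g * s, ?_, ?_⟩
    · rw [SimpleGraph.Walk.length_cons, pow_succ]
      exact mul_mem_mul hg (mem_insert_of_mem _ hs)
    · simp only [Embedding.subtype_apply] at hb
      rw [hq, hb, QuotientGroup.mk_mul, mul_assoc]

/-- If `N` contains no nontrivial word of length at most `2 m + 1`, then every set of at most `m`
elements of `Γ ⧸ N` lifts to `Γ` compatibly with its Cayley edges. -/
lemma exists_lift_of_ncard_le {Γ : Type u} [Group Γ] {N : Subgroup Γ} [hN : N.Normal]
    [N.FiniteIndex] {S : Set Γ} (hS : ∀ s ∈ S, s⁻¹ ∈ S) {m : ℕ}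
    (hsmall : ∀ g ∈ (insert 1 S ^ m)⁻¹ * insert 1 S * insert 1 S ^ m, g ∈ N → g = 1)
    {M : Set (Γ ⧸ N)} (hM : M.ncard ≤ m) :
    ∃ σ : M → Γ, (∀ p, (σ p : Γ ⧸ N) = p) ∧
      ∀ p q : M, ∀ s ∈ S, (q : Γ ⧸ N) = (s : Γ ⧸ N) * p → σ q = s * σ p := by
  have hone : (1 : Γ) ∈ insert 1 S := mem_insert _ _
  let H := (cayleyQuot N hN S).induce M
  let root (p : M) : M := (H.connectedComponentMk p).out
  have hword (p : M) : ∃ g ∈ insert 1 S ^ m, (p : Γ ⧸ N) = (g : Γ ⧸ N) * root p := by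
    have hreach : H.Reachable (root p) p :=
      SimpleGraph.ConnectedComponent.exact (Quot.out_eq _)
    obtain ⟨w, hw⟩ := hreach.exists_isPath
    obtain ⟨g, hg, hp⟩ := exists_mem_pow_of_walk hS w
    refine ⟨g, pow_subset_pow_right hone ?_ hg, hp⟩
    have := Fintype.ofFinite M
    have := hw.length_lt
    rw [← Nat.card_eq_fintype_card, Nat.card_coe_set_eq] at this
    omega
  choose g hg hgp using hword
  have hlift (p : M) : ((g p * (root p : Γ ⧸ N).out : Γ) : Γ ⧸ N) = p := by
    rw [QuotientGroup.mk_mul, QuotientGroup.out_eq', ← hgp]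
  refine ⟨fun p => g p * (root p : Γ ⧸ N).out, hlift, fun p q s hs hpq => ?_⟩
  have hroot : root q = root p := by
    by_cases heq : p = q
    · rw [heq]
    · have hadj : H.Adj p q := SimpleGraph.comap_adj.2
        ((cayleyQuot_adj hS).2 ⟨fun h => heq (Subtype.ext h), s, hs, hpq⟩)
      exact congrArg Quot.out (SimpleGraph.ConnectedComponent.sound hadj.reachable.symm)
  have hmem : (g q)⁻¹ * s * g p ∈ N := by
    rw [← QuotientGroup.eq_one_iff]
    have h : (g q : Γ ⧸ N) * root p = s * (g p * root p) := by
      rw [← hgp p, ← hroot, ← hgp q, hpq]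
    rw [← mul_assoc] at h
    rw [QuotientGroup.mk_mul, QuotientGroup.mk_mul, QuotientGroup.mk_inv, mul_assoc,
      ← mul_right_cancel h, inv_mul_cancel]
  have heq := hsmall _ (mul_mem_mul (mul_mem_mul (inv_mem_inv.2 (hg q))
    (mem_insert_of_mem _ hs)) (hg p)) hmem
  rw [mul_assoc, inv_mul_eq_one] at heq
  simp only [hroot, heq, mul_assoc]

/-- The edge boundary of a compatible lift injects into that of the original set. -/
lemma ncard_edgeBoundary_range_le {Γ : Type u} [Group Γ] {N : Subgroup Γ} [hN : N.Normal]
    [N.FiniteIndex] {S : Set Γ} (hS : ∀ s ∈ S, s⁻¹ ∈ S)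
    (hinj : InjOn (QuotientGroup.mk : Γ → Γ ⧸ N) S) {M : Set (Γ ⧸ N)} {σ : M → Γ}
    (hσ : ∀ p, (σ p : Γ ⧸ N) = p)
    (hσS : ∀ p q : M, ∀ s ∈ S, (q : Γ ⧸ N) = (s : Γ ⧸ N) * p → σ q = s * σ p) :
    (edgeBoundary (cayley Γ S) (range σ)).ncard ≤
      (edgeBoundary (cayleyQuot N hN S) M).ncard := by
  have hform : ∀ e ∈ edgeBoundary (cayley Γ S) (range σ),
      ∃ p : M, ∃ s ∈ S, (s : Γ ⧸ N) * p ∉ M ∧ e = s(σ p, s * σ p) := by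
    rintro e ⟨he, x, hx, y, hy, ⟨p, rfl⟩, hyF⟩
    have hne : σ p ≠ y := fun h => hyF ⟨p, h⟩
    obtain rfl := (Sym2.mem_and_mem_iff hne).1 ⟨hx, hy⟩
    rw [SimpleGraph.mem_edgeSet, cayley_adj hS] at he
    obtain ⟨-, s, hs, rfl⟩ := he
    exact ⟨p, s, hs, fun h => hyF ⟨⟨_, h⟩, hσS p ⟨_, h⟩ s hs rfl⟩, rfl⟩
  refine ncard_le_ncard_of_injOn (Sym2.map QuotientGroup.mk) ?_ ?_ (toFinite _)
  · intro e he
    obtain ⟨p, s, hs, hsp, rfl⟩ := hform e he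
    rw [Sym2.map_mk, QuotientGroup.mk_mul, hσ]
    have hne : (p : Γ ⧸ N) ≠ s * p := fun h => hsp (h ▸ p.2)
    refine ⟨(cayleyQuot_adj hS).2 ⟨hne, s, hs, rfl⟩,
      _, Sym2.mem_mk_left _ _, _, Sym2.mem_mk_right _ _, p.2, hsp⟩
  · intro e he e' he' h
    obtain ⟨p, s, hs, hsp, rfl⟩ := hform e he
    obtain ⟨q, t, ht, htq, rfl⟩ := hform e' he'
    simp only [Sym2.map_mk, QuotientGroup.mk_mul, hσ, Sym2.eq_iff] at h
    obtain ⟨hpq, hst⟩ | ⟨hpq, -⟩ := h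
    · obtain rfl := Subtype.ext hpq
      rw [hinj hs ht (mul_right_cancel hst)]
    · exact absurd (hpq ▸ p.2) htq

lemma finite_pow {Γ : Type u} [Group Γ] {B : Set Γ} (hB : B.Finite) (k : ℕ) :
    (B ^ k).Finite := by
  induction k with
  | zero => simp
  | succ k ih => rw [pow_succ]; exact ih.mul hB

lemma eventually_forall_mem_eq_one {Γ : Type u} [Group Γ] {N : ℕ → Subgroup Γ}
    (hN : Antitone N) (hinter : ⨅ n, N n = ⊥) {K : Set Γ} (hK : K.Finite) :
    ∀ᶠ n in atTop, ∀ g ∈ K, g ∈ N n → g = 1 := by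
  refine (eventually_all_finite hK).2 fun g _ => ?_
  by_cases hg : ∀ n, g ∈ N n
  · have : g ∈ ⨅ n, N n := Subgroup.mem_iInf.2 hg
    rw [hinter, Subgroup.mem_bot] at this
    exact Eventually.of_forall fun _ _ => this
  · push Not at hg
    obtain ⟨k, hk⟩ := hg
    filter_upwards [eventually_ge_atTop k] with n hn hgn using absurd (hN hn hgn) hk

theorem expansion_passes_to_quotients {Γ : Type u} [Group Γ] (S : Set Γ)
    (hSfin : S.Finite) (hSsym : ∀ s ∈ S, s⁻¹ ∈ S) (hSgen : Subgroup.closure S = ⊤)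
    (hnonam : ¬ IsAmenableFolner Γ)
    (δ : ℝ) (hδ : 0 < δ)
    (hexp : ∀ F : Set Γ, F.Finite → δ * F.ncard ≤ ((edgeBoundary (cayley Γ S) F).ncard : ℝ))
    (N : ℕ → Subgroup Γ) (hnorm : ∀ n, (N n).Normal)
    (hnested : ∀ n, N (n + 1) ≤ N n) (hfi : ∀ n, (N n).FiniteIndex)
    (hinter : ⨅ n, N n = ⊥) :
    ∀ m : ℕ, 0 < m → ∃ N₀ : ℕ, ∀ n, N₀ ≤ n →
      ∀ M : Set (Γ ⧸ N n), M.ncard ≤ m →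
        δ * M.ncard ≤ ((edgeBoundary (cayleyQuot (N n) (hnorm n) S) M).ncard : ℝ) := by
  intro m hm
  have hB : (insert 1 S).Finite := hSfin.insert 1
  have hBm : (insert 1 S ^ m).Finite := finite_pow hB m
  have hone : (1 : Γ) ∈ insert 1 S := mem_insert _ _
  obtain ⟨N₀, hN₀⟩ := eventually_atTop.1 (eventually_forall_mem_eq_one
    (antitone_nat_of_succ_le hnested) hinter ((hBm.inv.mul hB).mul hBm))
  refine ⟨N₀, fun n hn M hM => ?_⟩
  have := hnorm n
  have := hfi n
  have hinj : InjOn (QuotientGroup.mk : Γ → Γ ⧸ N n) S := fun s hs t ht hst =>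
    inv_mul_eq_one.1 <| hN₀ n hn _
      (mul_one (s⁻¹ * t) ▸ mul_mem_mul (mul_mem_mul
        (inv_mem_inv.2 (subset_pow hone hm.ne' (mem_insert_of_mem _ hs)))
        (mem_insert_of_mem _ ht)) (one_mem_pow hone))
      (QuotientGroup.eq.1 hst)
  obtain ⟨σ, hσ, hσS⟩ := exists_lift_of_ncard_le hSsym (hN₀ n hn) hM
  have hσinj : Injective σ := fun p q h => Subtype.ext (by rw [← hσ p, h, hσ q])
  have hcard : (range σ).ncard = M.ncard := by
    rw [← image_univ, ncard_image_of_injective _ hσinj, ncard_univ, Nat.card_coe_set_eq]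
  calc δ * M.ncard = δ * (range σ).ncard := by rw [hcard]
    _ ≤ (edgeBoundary (cayley Γ S) (range σ)).ncard := hexp _ (finite_range σ)
    _ ≤ (edgeBoundary (cayleyQuot (N n) (hnorm n) S) M).ncard :=
      mod_cast ncard_edgeBoundary_range_le hSsym hinj hσ hσS

end GraphSeqPaper
end

section
/- Let Γ be a finitely generated amenable group with finite symmetric generating set S, let Γ ⊳ Γ_1 ⊳ Γ_2 ⊳ … be a nested sequence of finite-index normal subgroups with ∩_{n=1}^∞ Γ_n = {1} and [Γ:Γ_n] → ∞, and let G_n be the Cayley graph of Γ/Γ_n with respect to the image of S. Then for every ω > 0 there exist L_ω > 0, M_ω > 0 and for every n ≥ M_ω a family of subsets W^1_n, …, W^{k_n}_n ⊆ V(G_n) such that for all 1 ≤ i ≤ k_n: (a) |W^i_n| ≤ L_ω; (b) |W^i_n ∖ ∪_{j≠i} W^j_n| ≥ (1−ω)|W^i_n|; (c) the number of edges of G_n from W^i_n to its complement is at most ω|W^i_n|; and moreover |∪_{i=1}^{k_n} W^i_n| ≥ (1−ω)|V(G_n)|. -/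
open Filter Function Set
open scoped Classical TensorProduct Pointwise symmDiff

universe u

namespace GraphSeqPaper

/-- In a uniformly random enumeration of `X`, the first element of `U` is uniformly distributed
on `U`. -/
lemma card_filter_first_mul_card {X : Type*} [Fintype X] {m : ℕ} (U : Finset X)
    {u : X} (hu : u ∈ U) :
    (Finset.univ.filter fun σ : X ≃ Fin m => ∀ w ∈ U, σ u ≤ σ w).card * U.card =
      Fintype.card (X ≃ Fin m) := by
  have hswap : ∀ v ∈ U, (Finset.univ.filter fun σ : X ≃ Fin m => ∀ w ∈ U, σ v ≤ σ w).card =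
      (Finset.univ.filter fun σ : X ≃ Fin m => ∀ w ∈ U, σ u ≤ σ w).card := by
    intro v hv
    have hmem : ∀ w ∈ U, Equiv.swap u v w ∈ U := by
      intro w hw
      rw [Equiv.swap_apply_def]
      split_ifs <;> assumption
    refine Finset.card_bij' (fun σ _ => (Equiv.swap u v).trans σ)
      (fun σ _ => (Equiv.swap u v).trans σ) ?_ ?_ ?_ ?_
    · intro σ hσ
      simp only [Finset.mem_filter, Finset.mem_univ, true_and] at hσ ⊢
      intro w hw
      simpa using hσ _ (hmem w hw)
    · intro σ hσ
      simp only [Finset.mem_filter, Finset.mem_univ, true_and] at hσ ⊢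
      intro w hw
      simpa using hσ _ (hmem w hw)
    · intro σ _
      ext x
      simp
    · intro σ _
      ext x
      simp
  have hunion : U.biUnion (fun v => Finset.univ.filter fun σ : X ≃ Fin m => ∀ w ∈ U, σ v ≤ σ w) =
      Finset.univ := by
    ext σ
    simpa using U.exists_min_image σ ⟨u, hu⟩
  have hdisj : (U : Set X).PairwiseDisjoint
      (fun v => Finset.univ.filter fun σ : X ≃ Fin m => ∀ w ∈ U, σ v ≤ σ w) := by
    intro v hv w hw hvw
    refine Finset.disjoint_left.2 fun σ h₁ h₂ => hvw ?_
    simp only [Finset.mem_filter, Finset.mem_univ, true_and] at h₁ h₂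
    exact σ.injective (le_antisymm (h₁ w hw) (h₂ v hv))
  have hcount := Finset.card_biUnion hdisj
  rw [hunion, Finset.card_univ, Finset.sum_congr rfl hswap, Finset.sum_const, smul_eq_mul] at hcount
  rw [hcount, mul_comm]

/-- If most pairs of a family have almost equal neighbourhoods `U`, some choice function for `U`
identifies most of the pairs. -/
lemma exists_choice_few_separated {V X ι : Type*} [Fintype X] (U : V → Finset X)
    (hU : ∀ v, (U v).Nonempty) (P : Finset ι) (a b : ι → V) (ε : ℝ)
    (h : ∀ p ∈ P, ((U (a p) ∆ U (b p)).card : ℝ) ≤ ε * (U (a p) ∪ U (b p)).card) :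
    ∃ f : V → X, (∀ v, f v ∈ U v) ∧
      ((P.filter fun p => f (a p) ≠ f (b p)).card : ℝ) ≤ ε * P.card := by
  choose g hgU hg using fun (σ : X ≃ Fin (Fintype.card X)) v => (U v).exists_min_image σ (hU v)
  have hpair : ∀ p ∈ P, ((Finset.univ.filter fun σ => g σ (a p) ≠ g σ (b p)).card : ℝ) ≤
      ε * Fintype.card (X ≃ Fin (Fintype.card X)) := by
    intro p hp
    set W := U (a p) ∪ U (b p) with hW
    have hWpos : (0 : ℝ) < W.card := by
      exact_mod_cast ((hU (a p)).mono Finset.subset_union_left).card_pos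
    have hsub : (Finset.univ.filter fun σ => g σ (a p) ≠ g σ (b p)) ⊆
        (U (a p) ∆ U (b p)).biUnion fun u =>
          Finset.univ.filter fun σ : X ≃ Fin (Fintype.card X) => ∀ w ∈ W, σ u ≤ σ w := by
      intro σ hσ
      simp only [Finset.mem_filter, Finset.mem_univ, true_and] at hσ
      obtain ⟨u, huW, hu⟩ := W.exists_min_image σ ((hU (a p)).mono Finset.subset_union_left)
      have heq : ∀ v, U v ⊆ W → u ∈ U v → g σ v = u := fun v hv huv =>
        σ.injective (le_antisymm (hg σ v u huv) (hu _ (hv (hgU σ v))))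
      simp only [Finset.mem_biUnion, Finset.mem_filter, Finset.mem_univ, true_and]
      refine ⟨u, ?_, hu⟩
      rw [Finset.mem_symmDiff]
      rcases Finset.mem_union.1 huW with hua | hub
      · refine Or.inl ⟨hua, fun hub => hσ ?_⟩
        rw [heq _ Finset.subset_union_left hua, heq _ Finset.subset_union_right hub]
      · refine Or.inr ⟨hub, fun hua => hσ ?_⟩
        rw [heq _ Finset.subset_union_left hua, heq _ Finset.subset_union_right hub]
    have hcard : (Finset.univ.filter fun σ => g σ (a p) ≠ g σ (b p)).card * W.card ≤
        (U (a p) ∆ U (b p)).card * Fintype.card (X ≃ Fin (Fintype.card X)) := by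
      refine (Nat.mul_le_mul_right _ ((Finset.card_le_card hsub).trans
        Finset.card_biUnion_le)).trans ?_
      rw [Finset.sum_mul, ← smul_eq_mul]
      refine Finset.sum_le_card_nsmul _ _ _ fun u hu => (card_filter_first_mul_card W ?_).le
      rcases Finset.mem_symmDiff.1 hu with hu | hu
      · exact Finset.mem_union_left _ hu.1
      · exact Finset.mem_union_right _ hu.1
    have hcard' : ((Finset.univ.filter fun σ => g σ (a p) ≠ g σ (b p)).card : ℝ) * W.card ≤
        (U (a p) ∆ U (b p)).card * Fintype.card (X ≃ Fin (Fintype.card X)) := by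
      exact_mod_cast hcard
    refine le_of_mul_le_mul_right (hcard'.trans ?_) hWpos
    calc _ ≤ ε * W.card * Fintype.card (X ≃ Fin (Fintype.card X)) := by gcongr; exact h p hp
      _ = _ := by ring
  have hne : (Finset.univ : Finset (X ≃ Fin (Fintype.card X))).Nonempty :=
    ⟨Fintype.equivFin X, Finset.mem_univ _⟩
  obtain ⟨σ, -, hσ⟩ := Finset.exists_le_of_sum_le hne
    (f := fun σ => ((P.filter fun p => g σ (a p) ≠ g σ (b p)).card : ℝ))
    (g := fun _ => ε * P.card) (by
      have hcount : ∑ σ : X ≃ Fin (Fintype.card X),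
          (P.filter fun p => g σ (a p) ≠ g σ (b p)).card =
          ∑ p ∈ P, (Finset.univ.filter fun σ => g σ (a p) ≠ g σ (b p)).card :=
        Finset.sum_card_bipartiteAbove_eq_sum_card_bipartiteBelow
          (fun σ p => g σ (a p) ≠ g σ (b p))
      have hcount' : ∑ σ : X ≃ Fin (Fintype.card X),
          ((P.filter fun p => g σ (a p) ≠ g σ (b p)).card : ℝ) =
          ∑ p ∈ P, ((Finset.univ.filter fun σ => g σ (a p) ≠ g σ (b p)).card : ℝ) := by
        exact_mod_cast hcount
      rw [hcount']
      refine (Finset.sum_le_sum hpair).trans_eq ?_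
      simp only [Finset.sum_const, nsmul_eq_mul, Finset.card_univ]
      ring)
  exact ⟨g σ, hgU σ, hσ⟩

/-- A finite group can be partitioned into subsets of translates of an almost invariant set
`A` so that few edges are cut; `f` sends a vertex to the label of its translate. -/
lemma exists_partition_of_almost_invariant {Q : Type*} [Group Q] [Fintype Q] (T A : Finset Q)
    (hA : A.Nonempty) (ε : ℝ) (hε : 0 ≤ ε)
    (h : ∀ t ∈ T, (((t • (A : Set Q)) ∆ A).ncard : ℝ) ≤ ε * A.card) :
    ∃ f : Q → Q, (∀ v, v * (f v)⁻¹ ∈ A) ∧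
      (((T ×ˢ Finset.univ).filter fun p : Q × Q => f p.2 ≠ f (p.1 * p.2)).card : ℝ) ≤
        ε * (T.card * Fintype.card Q) := by
  set U : Q → Finset Q := fun v => Finset.univ.filter fun x => v * x⁻¹ ∈ A with hUdef
  have hmem : ∀ v x, x ∈ U v ↔ v * x⁻¹ ∈ A := by simp [hUdef]
  have hcard : ∀ v, A.card ≤ (U v).card := fun v =>
    Finset.card_le_card_of_injOn (fun y => y⁻¹ * v) (by intro y hy; simpa [hmem] using hy)
      (by intro y _ z _ hyz; simpa using hyz)
  obtain ⟨f, hf, hcut⟩ := exists_choice_few_separated U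
    (fun v => Finset.card_pos.1 (hA.card_pos.trans_le (hcard v))) (T ×ˢ Finset.univ)
    Prod.snd (fun p => p.1 * p.2) ε (by
      rintro ⟨t, v⟩ hp
      have ht : t ∈ T := (Finset.mem_product.1 hp).1
      have hle : (U v ∆ U (t * v)).card ≤ ((t • (A : Set Q)) ∆ A).ncard := by
        rw [← Set.ncard_coe_finset]
        refine Set.ncard_le_ncard_of_injOn (fun x => t * (v * x⁻¹)) ?_ ?_ (Set.toFinite _)
        · intro x hx
          simpa [Set.mem_symmDiff, Finset.mem_symmDiff, hmem, Set.mem_smul_set_iff_inv_smul_mem,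
            mul_assoc] using hx
        · intro x _ y _ hxy
          simpa using hxy
      calc ((U v ∆ U (t * v)).card : ℝ) ≤ ((t • (A : Set Q)) ∆ A).ncard := by exact_mod_cast hle
        _ ≤ ε * A.card := h t ht
        _ ≤ ε * (U v ∪ U (t * v)).card := by
          have hle := (hcard v).trans
            (Finset.card_le_card (Finset.subset_union_left (s₂ := U (t * v))))
          exact mul_le_mul_of_nonneg_left (by exact_mod_cast hle) hε)
  refine ⟨f, fun v => (hmem _ _).1 (hf v), ?_⟩
  simpa [Finset.card_product] using hcut

/-- The edge boundary of `W` in a Cayley graph is controlled by the pairs `(t, v)` with `v ∈ W`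
and `t * v ∉ W`. -/
lemma ncard_edgeBoundary_cayley_le {Q : Type u} [Group Q] [Fintype Q] (T : Finset Q)
    (hT : ∀ t ∈ T, t⁻¹ ∈ T) (W : Set Q) :
    (edgeBoundary (cayley Q T) W).ncard ≤
      ((T ×ˢ Finset.univ).filter fun p : Q × Q => p.2 ∈ W ∧ p.1 * p.2 ∉ W).card := by
  refine le_trans (Set.ncard_le_ncard (t := (fun p : Q × Q => s(p.2, p.1 * p.2)) ''
    ((T ×ˢ Finset.univ).filter fun p : Q × Q => p.2 ∈ W ∧ p.1 * p.2 ∉ W)) ?_ (Set.toFinite _))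
    ((Set.ncard_image_le (Set.toFinite _)).trans_eq (Set.ncard_coe_finset _))
  rintro e ⟨he, x, hx, y, hy, hxW, hyW⟩
  have hxy : x ≠ y := fun h => hyW (h ▸ hxW)
  obtain rfl := (Sym2.mem_and_mem_iff hxy).1 ⟨hx, hy⟩
  have hadj : y * x⁻¹ ∈ T := by
    rw [SimpleGraph.mem_edgeSet, cayley, SimpleGraph.fromRel_adj] at he
    rcases he.2 with h | h
    · simpa using h
    · have hinv := hT (x * y⁻¹) h
      rwa [mul_inv_rev, inv_inv] at hinv
  exact ⟨(y * x⁻¹, x), by simp [hadj, hxW, hyW], by simp⟩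

/-- A finite Cayley graph with a sufficiently invariant set `A` is, up to a small proportion of
vertices, a disjoint union of sets of size at most `|A|` and small edge boundary. -/
lemma exists_disjoint_small_boundary {Q : Type u} [Group Q] [Fintype Q] (T A : Finset Q)
    (hT : ∀ t ∈ T, t⁻¹ ∈ T) (hA : A.Nonempty) (ω ε : ℝ) (hω : 0 < ω) (hε : 0 ≤ ε)
    (hεω : ε * T.card ≤ ω ^ 2)
    (h : ∀ t ∈ T, (((t • (A : Set Q)) ∆ A).ncard : ℝ) ≤ ε * A.card) :
    ∃ (k : ℕ) (W : Fin k → Set Q), (∀ i, (W i).ncard ≤ A.card) ∧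
      (∀ i j, i ≠ j → Disjoint (W i) (W j)) ∧
      (∀ i, ((edgeBoundary (cayley Q T) (W i)).ncard : ℝ) ≤ ω * (W i).ncard) ∧
      (1 - ω) * (Nat.card Q : ℝ) ≤ ((⋃ i, W i).ncard : ℝ) := by
  obtain ⟨f, hf, hcut⟩ := exists_partition_of_almost_invariant T A hA ε hε h
  set C : Q → Set Q := fun x => f ⁻¹' {x} with hC
  set B : Q → Finset (Q × Q) := fun x =>
    (T ×ˢ Finset.univ).filter fun p : Q × Q => p.2 ∈ C x ∧ p.1 * p.2 ∉ C x with hB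
  set good : Finset Q := Finset.univ.filter fun x => ((B x).card : ℝ) ≤ ω * (C x).ncard with hgood
  have hCcard : ∀ s : Finset Q, (f ⁻¹' (s : Set Q)).ncard = ∑ x ∈ s, (C x).ncard := by
    intro s
    have hfin : f ⁻¹' (s : Set Q) = (Finset.univ.filter fun v => f v ∈ s : Finset Q) := by
      ext; simp
    rw [hfin, Set.ncard_coe_finset,
      Finset.card_eq_sum_card_fiberwise (f := f) (t := s) (by intro v hv; simpa using hv)]
    refine Finset.sum_congr rfl fun x hx => ?_
    rw [← Set.ncard_coe_finset]
    congr 1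
    ext v
    simp only [Finset.coe_filter, Finset.mem_filter, Finset.mem_univ, true_and, hC,
      Set.mem_ofPred_eq, Set.mem_preimage, Set.mem_singleton_iff]
    exact ⟨fun hv => hv.2, fun hv => ⟨hv ▸ hx, hv⟩⟩
  have hBsum : ∑ x, (B x).card =
      ((T ×ˢ Finset.univ).filter fun p : Q × Q => f p.2 ≠ f (p.1 * p.2)).card := by
    rw [Finset.card_eq_sum_card_fiberwise (f := fun p : Q × Q => f p.2) (t := Finset.univ)
      (by intro v _; simp)]
    refine Finset.sum_congr rfl fun x _ => ?_
    congr 1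
    ext p
    simp only [hB, hC, Finset.mem_filter, Set.mem_preimage, Set.mem_singleton_iff]
    constructor
    · rintro ⟨h₁, rfl, h₃⟩
      exact ⟨⟨h₁, fun e => h₃ e.symm⟩, rfl⟩
    · rintro ⟨⟨h₁, h₂⟩, rfl⟩
      exact ⟨h₁, rfl, fun e => h₂ e.symm⟩
  have hBsum' : ∑ x, ((B x).card : ℝ) ≤ ω ^ 2 * Fintype.card Q := by
    rw [← Nat.cast_sum, hBsum]
    refine hcut.trans ?_
    rw [← mul_assoc]
    gcongr
  have hbad : (∑ x ∈ goodᶜ, ((C x).ncard : ℝ)) ≤ ω * Fintype.card Q := by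
    refine le_of_mul_le_mul_left ?_ hω
    calc ω * ∑ x ∈ goodᶜ, ((C x).ncard : ℝ) = ∑ x ∈ goodᶜ, ω * ((C x).ncard : ℝ) :=
          Finset.mul_sum ..
      _ ≤ ∑ x ∈ goodᶜ, ((B x).card : ℝ) := by
          refine Finset.sum_le_sum fun x hx => ?_
          simp only [hgood, Finset.mem_compl, Finset.mem_filter, Finset.mem_univ, true_and,
            not_le] at hx
          exact hx.le
      _ ≤ ∑ x, ((B x).card : ℝ) :=
          Finset.sum_le_sum_of_subset_of_nonneg (Finset.subset_univ _) fun _ _ _ => by positivity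
      _ ≤ ω * (ω * Fintype.card Q) := by rw [← mul_assoc, ← sq]; exact hBsum'
  have htotal : ∑ x, ((C x).ncard : ℝ) = Fintype.card Q := by
    rw [← Nat.cast_sum, ← hCcard]
    simp [Set.ncard_univ]
  refine ⟨good.card, fun i => C (good.equivFin.symm i), fun i => ?_, fun i j hij => ?_,
    fun i => ?_, ?_⟩
  · rw [← Set.ncard_coe_finset A]
    refine Set.ncard_le_ncard_of_injOn (fun v => v * (good.equivFin.symm i : Q)⁻¹) ?_ ?_
      (Set.toFinite _)
    · intro v hv
      have hfv : f v = good.equivFin.symm i := hv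
      simpa [← hfv] using hf v
    · intro v _ w _ hvw
      simpa using hvw
  · refine Disjoint.preimage f ?_
    rw [Set.disjoint_singleton]
    exact fun e => hij (good.equivFin.symm.injective (Subtype.ext e))
  · have hi := (good.equivFin.symm i).2
    exact le_trans (by exact_mod_cast ncard_edgeBoundary_cayley_le T hT _)
      (Finset.mem_filter.1 hi).2
  · have hunion : (⋃ i, C (good.equivFin.symm i)) = f ⁻¹' (good : Set Q) := by
      ext v
      simp only [Set.mem_iUnion, hC, Set.mem_preimage, Set.mem_singleton_iff, Finset.mem_coe]
      constructor
      · rintro ⟨i, hi⟩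
        rw [hi]
        exact (good.equivFin.symm i).2
      · intro hv
        exact ⟨good.equivFin ⟨f v, hv⟩, by simp⟩
    rw [hunion, hCcard, Nat.cast_sum, Nat.card_eq_fintype_card]
    have := Finset.sum_add_sum_compl good fun x => ((C x).ncard : ℝ)
    linarith

/-- In a residual chain of subgroups, the quotient maps are eventually injective on any finite
set. -/
lemma exists_injOn_quotient {Γ : Type*} [Group Γ] {N : ℕ → Subgroup Γ} (hN : Antitone N)
    (hinter : ⨅ n, N n = ⊥) {A : Set Γ} (hA : A.Finite) :
    ∃ M, ∀ n, M ≤ n → InjOn (fun g : Γ => (g : Γ ⧸ N n)) A := by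
  have hsep : ∀ g : Γ, ∃ M, g ∈ N M → g = 1 := by
    intro g
    by_contra! hg
    have hmem : g ∈ ⨅ n, N n := Subgroup.mem_iInf.2 fun n => (hg n).1
    rw [hinter, Subgroup.mem_bot] at hmem
    exact (hg 0).2 hmem
  choose M hM using hsep
  obtain ⟨m, hm⟩ := ((hA.prod hA).image fun p : Γ × Γ => M (p.1⁻¹ * p.2)).bddAbove
  refine ⟨m, fun n hn x hx y hy hxy => ?_⟩
  have hle : M (x⁻¹ * y) ≤ n := (hm ⟨(x, y), ⟨hx, hy⟩, rfl⟩).trans hn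
  exact inv_mul_eq_one.1 (hM _ (hN hle (QuotientGroup.eq.1 hxy)))

/-- Translates of the image of a set under a homomorphism move no more than translates of the
set itself. -/
lemma ncard_smul_image_symmDiff_le {G H : Type*} [Group G] [Group H] (φ : G →* H) (s : G)
    {A : Set G} (hA : A.Finite) :
    ((φ s • (φ '' A)) ∆ (φ '' A)).ncard ≤ ((s • A) ∆ A).ncard := by
  have hfin : ((s • A) ∆ A).Finite := (hA.smul_set).symmDiff hA
  refine (Set.ncard_le_ncard ?_ (hfin.image φ)).trans (Set.ncard_image_le hfin)
  have himage : φ s • (φ '' A) = φ '' (s • A) := by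
    ext y
    simp [Set.mem_smul_set]
  rw [himage]
  rintro _ (⟨⟨x, hx, rfl⟩, h⟩ | ⟨⟨x, hx, rfl⟩, h⟩)
  · exact ⟨x, Or.inl ⟨hx, fun hxA => h ⟨x, hxA, rfl⟩⟩, rfl⟩
  · exact ⟨x, Or.inr ⟨hx, fun hxA => h ⟨x, hxA, rfl⟩⟩, rfl⟩

theorem folner_decomposition_of_amenable {Γ : Type u} [Group Γ] (S : Set Γ)
    (hSfin : S.Finite) (hSsym : ∀ s ∈ S, s⁻¹ ∈ S) (hSgen : Subgroup.closure S = ⊤)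
    (N : ℕ → Subgroup Γ) (hnorm : ∀ n, (N n).Normal)
    (hnested : ∀ n, N (n + 1) ≤ N n) (hfi : ∀ n, (N n).FiniteIndex)
    (hinter : ⨅ n, N n = ⊥)
    (hidx : Tendsto (fun n => (N n).index) atTop atTop)
    (hAm : IsAmenableFolner Γ) :
    ∀ ω : ℝ, 0 < ω → ∃ Lω : ℕ, 0 < Lω ∧ ∃ Mω : ℕ, 0 < Mω ∧ ∀ n, Mω ≤ n →
      ∃ (k : ℕ) (W : Fin k → Set (Γ ⧸ N n)),
        (∀ i, (W i).ncard ≤ Lω) ∧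
        (∀ i, (1 - ω) * ((W i).ncard : ℝ) ≤ (((W i) \ ⋃ j ∈ {j | j ≠ i}, W j).ncard : ℝ)) ∧
        (∀ i, ((edgeBoundary (cayleyQuot (N n) (hnorm n) S) (W i)).ncard : ℝ) ≤
          ω * ((W i).ncard : ℝ)) ∧
        (1 - ω) * (Nat.card (Γ ⧸ N n) : ℝ) ≤ ((⋃ i, W i).ncard : ℝ) := by
  intro ω hω
  obtain ⟨A, hAfin, hAne, hAS⟩ := hAm S hSfin (ω ^ 2 / (S.ncard + 1)) (by positivity)
  obtain ⟨M, hM⟩ := exists_injOn_quotient (antitone_nat_of_succ_le hnested) hinter hAfin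
  refine ⟨A.ncard, (Set.ncard_pos hAfin).2 hAne, M + 1, M.succ_pos, fun n hn => ?_⟩
  have := hnorm n
  have := hfi n
  have : Fintype (Γ ⧸ N n) := Fintype.ofFinite _
  set φ : Γ →* Γ ⧸ N n := QuotientGroup.mk' (N n)
  have hcardA : (φ '' A).ncard = A.ncard := (hM n (by omega)).ncard_image
  have hcardT : (φ '' S).ncard ≤ S.ncard := Set.ncard_image_le hSfin
  have hA' : ((φ '' A).toFinset).card = A.ncard := by rw [← Set.ncard_eq_toFinset_card', hcardA]
  have hT' : ((φ '' S).toFinset).card ≤ S.ncard := by rwa [← Set.ncard_eq_toFinset_card']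
  obtain ⟨k, W, hsize, hdisj, hbdry, hcover⟩ := exists_disjoint_small_boundary
    (φ '' S).toFinset (φ '' A).toFinset
    (by
      intro t ht
      obtain ⟨s, hs, rfl⟩ := Set.mem_toFinset.1 ht
      exact Set.mem_toFinset.2 ⟨s⁻¹, hSsym s hs, map_inv φ s⟩)
    (by simpa using hAne) ω (ω ^ 2 / (S.ncard + 1)) hω (by positivity)
    (by
      have hle : (((φ '' S).toFinset).card : ℝ) ≤ S.ncard + 1 := by
        exact_mod_cast hT'.trans (Nat.le_succ _)
      rw [div_mul_eq_mul_div, div_le_iff₀ (by positivity)]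
      gcongr)
    (by
      intro t ht
      obtain ⟨s, hs, rfl⟩ := Set.mem_toFinset.1 ht
      rw [hA', Set.coe_toFinset]
      exact le_trans (by exact_mod_cast ncard_smul_image_symmDiff_le φ s hAfin) (hAS s hs))
  refine ⟨k, W, fun i => (hsize i).trans_eq hA', fun i => ?_, fun i => ?_, hcover⟩
  · have hdiff : W i \ ⋃ j ∈ {j | j ≠ i}, W j = W i := by
      rw [sdiff_eq_left, Set.disjoint_iUnion₂_right]
      exact fun j hj => hdisj i j (Ne.symm hj)
    rw [hdiff]
    nlinarith [Nat.cast_nonneg (α := ℝ) (W i).ncard]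
  · have hi := hbdry i
    rwa [Set.coe_toFinset] at hi

end GraphSeqPaper
end
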